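/- arXiv:0809.0401 — 4 statements merged into one kernel-verified Lean document; each statement's English description precedes it below -/
import Mathlib

section
/- Let 𝕂 = ℝ or ℂ and let F(z,w) = Σ_{α ∈ ℕⁿ} P_α(z) w^α be a formal power series in w = (w₁,…,wₙ) with coefficients P_α ∈ 𝕂[z₁,…,zₙ]. Then F converges on all of ℂ^{2n} to an entire function that is a limit, uniformly on compact subsets of ℂ^{2n}, of stable polynomials in 2n variables with coefficients in 𝕂, if and only if for every β ∈ ℕⁿ the polynomial Σ_{α ≤ β} (β)_α P_α(z) w^α in 2n variables is either stable (with coefficients in 𝕂) or identically zero. Here (β)_α = β!/(β−α)! if α ≤ β and (β)_α = 0 otherwise. -/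
open MvPolynomial

/-- A complex polynomial is *stable* if it is non-vanishing whenever all
variables lie in the open upper half-plane. -/
def IsStable {σ : Type*} (f : MvPolynomial σ ℂ) : Prop :=
  ∀ z : σ → ℂ, (∀ i, 0 < (z i).im) → MvPolynomial.eval z f ≠ 0

/-- A real polynomial is *real stable* if it is non-vanishing whenever all
variables lie in the open upper half-plane. -/
def IsRealStable {σ : Type*} (f : MvPolynomial σ ℝ) : Prop :=
  ∀ z : σ → ℂ, (∀ i, 0 < (z i).im) → MvPolynomial.aeval z f ≠ 0

/-- The Jensen-type truncation `∑_{α ≤ β} (β)_α P_α(z) w^α` of a formal power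
series `F(z,w) = ∑_α P_α(z) w^α`, as a polynomial in `2n` variables (the
`z`-variables indexed by `Sum.inl`, the `w`-variables by `Sum.inr`).  Here
`(β)_α = β!/(β-α)! = ∏ᵢ (βᵢ)·(βᵢ-1)⋯(βᵢ-αᵢ+1)` (which vanishes unless
`α ≤ β`). -/
noncomputable def jensenTrunc {n : ℕ} {K : Type*} [CommSemiring K]
    (P : (Fin n →₀ ℕ) → MvPolynomial (Fin n) K) (β : Fin n →₀ ℕ) :
    MvPolynomial (Fin n ⊕ Fin n) K :=
  ∑ α ∈ Finset.Iic β,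
    C ((∏ i, (β i).descFactorial (α i) : ℕ) : K) *
      (rename Sum.inl (P α) * monomial (Finsupp.mapDomain Sum.inr α) 1)

namespace Polynomial

theorem eval_derivative_sub_mul_ne_zero {f : ℂ[X]}
    (hf : ∀ y : ℂ, y.im < 0 → f.eval y ≠ 0) {ζ : ℂ} (hζ : ζ ≠ 0) (hζ' : ζ.im ≤ 0)
    {y : ℂ} (hy : y.im < 0) : (derivative f - C ζ * f).eval y ≠ 0 := by
  intro h
  have hfy := hf y hy
  have h1 := (IsAlgClosed.splits f).eval_derivative_eq_eval_mul_sum hfy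
  have h2 : (f.roots.map fun z ↦ 1 / (y - z)).sum = ζ := by
    simp only [eval_sub, eval_mul, eval_C] at h
    rw [h1] at h
    have : f.eval y * ((f.roots.map fun z ↦ 1 / (y - z)).sum - ζ) = 0 := by
      linear_combination h
    exact sub_eq_zero.1 ((mul_eq_zero.1 this).resolve_left hfy)
  have key : ∀ s : Multiset ℂ, (∀ r ∈ s, 0 ≤ r.im) →
      s = 0 ∨ 0 < ((s.map fun z ↦ 1 / (y - z)).sum).im := by
    intro s
    induction s using Multiset.induction with
    | empty => simp
    | cons a s ih =>
      intro hs
      right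
      have ha : 0 < (1 / (y - a)).im := by
        have := hs a (by simp)
        rw [one_div, Complex.inv_im, Complex.sub_im]
        apply div_pos (by linarith)
        apply Complex.normSq_pos.2
        intro h0
        have := congrArg Complex.im h0
        simp only [Complex.sub_im, Complex.zero_im] at this
        linarith
      rcases ih (fun r hr ↦ hs r (Multiset.mem_cons_of_mem hr)) with h | h
      · simpa [h] using ha
      · simp only [Multiset.map_cons, Multiset.sum_cons, Complex.add_im]
        linarith
  rcases key f.roots (fun r hr ↦ by
    by_contra! hlt
    exact hf r hlt (isRoot_of_mem_roots hr)) with h0 | h0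
  · rw [h0] at h2
    exact hζ (by simpa using h2.symm)
  · rw [h2] at h0
    linarith

theorem eval_aeval_derivative_ne_zero {f : ℂ[X]}
    (hf : ∀ y : ℂ, y.im < 0 → f.eval y ≠ 0) {p : ℂ[X]}
    (hp : ∀ t : ℂ, t = 0 ∨ 0 < t.im → p.eval t ≠ 0) {y : ℂ} (hy : y.im < 0) :
    (aeval (derivative : Module.End ℂ ℂ[X]) p f).eval y ≠ 0 := by
  have key : ∀ s : Multiset ℂ, (∀ r ∈ s, r ≠ 0 ∧ r.im ≤ 0) → ∀ y : ℂ, y.im < 0 →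
      (aeval (derivative : Module.End ℂ ℂ[X]) (s.map fun a ↦ X - C a).prod f).eval y ≠ 0 := by
    intro s
    induction s using Multiset.induction with
    | empty => simpa using hf
    | cons a s ih =>
      intro hs y hy
      have := eval_derivative_sub_mul_ne_zero
        (ih fun r hr ↦ hs r (Multiset.mem_cons_of_mem hr)) (hs a (by simp)).1
        (hs a (by simp)).2 hy
      simpa [Algebra.algebraMap_eq_smul_one] using this
  have hp0 : p ≠ 0 := fun h ↦ hp 0 (Or.inl rfl) (by simp [h])
  have hsp := (IsAlgClosed.splits p).eq_prod_roots
  rw [hsp, map_mul, aeval_C]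
  simp only [Module.End.mul_apply, Module.algebraMap_end_apply, eval_smul]
  refine smul_ne_zero (leadingCoeff_ne_zero.2 hp0) (key _ (fun r hr ↦ ?_) y hy)
  have hr' : p.eval r = 0 := isRoot_of_mem_roots hr
  constructor
  · rintro rfl
    exact hp 0 (Or.inl rfl) hr'
  · by_contra! h
    exact hp r (Or.inr h) hr'

theorem sum_descFactorial_mul_ne_zero {p : ℂ[X]}
    (hp : ∀ t : ℂ, t = 0 ∨ 0 < t.im → p.eval t ≠ 0) (b : ℕ) {t : ℂ} (ht : t = 0 ∨ 0 < t.im) :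
    p.sum (fun a c ↦ c * b.descFactorial a * t ^ a) ≠ 0 := by
  by_cases ht0 : t = 0
  · subst ht0
    have : p.sum (fun a c ↦ c * b.descFactorial a * (0 : ℂ) ^ a) = p.eval 0 := by
      rw [eval_eq_sum]
      refine Finset.sum_congr rfl fun a _ ↦ ?_
      rcases Nat.eq_zero_or_pos a with rfl | ha
      · simp
      · simp [ha.ne']
    rw [this]
    exact hp 0 (Or.inl rfl)
  have htim : 0 < t.im := ht.resolve_left ht0
  have hy : (t⁻¹).im < 0 := by
    rw [Complex.inv_im]
    exact div_neg_of_neg_of_pos (by linarith) (Complex.normSq_pos.2 ht0)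
  have h1 := eval_aeval_derivative_ne_zero (f := X ^ b) (fun y hy ↦ by
    simp only [eval_pow, eval_X]
    exact pow_ne_zero _ fun h ↦ by simp [h] at hy) hp hy
  have h2 : p.sum (fun a c ↦ c * b.descFactorial a * t ^ a) =
      t ^ b * (aeval (derivative : Module.End ℂ ℂ[X]) p (X ^ b)).eval t⁻¹ := by
    rw [aeval_eq_sum_range, Polynomial.sum_over_range _ (by simp), LinearMap.sum_apply,
      eval_finsetSum, Finset.mul_sum]
    refine Finset.sum_congr rfl fun a _ ↦ ?_
    rw [LinearMap.smul_apply, Module.End.pow_apply, iterate_derivative_X_pow_eq_natCast_mul]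
    simp only [eval_smul, eval_mul, eval_natCast, eval_pow, eval_X, smul_eq_mul]
    rcases le_or_gt a b with hab | hab
    · obtain ⟨c, rfl⟩ := Nat.exists_eq_add_of_le hab
      rw [Nat.add_sub_cancel_left, pow_add]
      have : t ^ c * t⁻¹ ^ c = 1 := by rw [← mul_pow, mul_inv_cancel₀ ht0, one_pow]
      linear_combination (-p.coeff a * (a + c).descFactorial a * t ^ a) * this
    · simp [Nat.descFactorial_of_lt hab]
  rw [h2]
  exact mul_ne_zero (pow_ne_zero _ ht0) h1

end Polynomial

theorem sum_descFactorial_mul_prod_pow_ne_zero {τ : Type*} [Fintype τ]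
    {s : Finset (τ →₀ ℕ)} {a : (τ →₀ ℕ) → ℂ}
    (h : ∀ x : τ → ℂ, (∀ i, x i = 0 ∨ 0 < (x i).im) → ∑ m ∈ s, a m * ∏ i, x i ^ m i ≠ 0)
    (j : τ) (b : ℕ) (x : τ → ℂ) (hx : ∀ i, x i = 0 ∨ 0 < (x i).im) :
    ∑ m ∈ s, a m * b.descFactorial (m j) * ∏ i, x i ^ m i ≠ 0 := by
  classical
  set p : Polynomial ℂ := ∑ m ∈ s,
    Polynomial.monomial (m j) (a m * ∏ i ∈ Finset.univ.erase j, x i ^ m i) with hp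
  have hprod : ∀ (t : ℂ) (m : τ →₀ ℕ), ∏ i, (Function.update x j t) i ^ m i =
      t ^ m j * ∏ i ∈ Finset.univ.erase j, x i ^ m i := by
    intro t m
    rw [← Finset.mul_prod_erase _ _ (Finset.mem_univ j), Function.update_self]
    congr 1
    refine Finset.prod_congr rfl fun i hi ↦ ?_
    rw [Function.update_of_ne (Finset.ne_of_mem_erase hi)]
  have h1 : ∀ t : ℂ, t = 0 ∨ 0 < t.im → p.eval t ≠ 0 := by
    intro t ht
    have := h (Function.update x j t) (fun i ↦ by
      by_cases hi : i = j
      · subst hi; simpa using ht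
      · simpa [hi] using hx i)
    convert this using 1
    rw [hp, Polynomial.eval_finsetSum]
    refine Finset.sum_congr rfl fun m _ ↦ ?_
    rw [hprod, Polynomial.eval_monomial]
    ring
  have h2 := Polynomial.sum_descFactorial_mul_ne_zero h1 b (hx j)
  convert h2 using 1
  have hadd : ∀ t : Finset (τ →₀ ℕ), (∑ m ∈ t, Polynomial.monomial (m j)
      (a m * ∏ i ∈ Finset.univ.erase j, x i ^ m i)).sum
        (fun a c ↦ c * b.descFactorial a * x j ^ a) =
      ∑ m ∈ t, a m * b.descFactorial (m j) * ∏ i, x i ^ m i := by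
    intro t
    induction t using Finset.induction with
    | empty => simp
    | insert m t hm ih =>
      rw [Finset.sum_insert hm, Finset.sum_insert hm, Polynomial.sum_add_index, ih,
        Polynomial.sum_monomial_index]
      · rw [← Finset.mul_prod_erase _ _ (Finset.mem_univ j)]
        ring
      · simp
      · simp
      · intros; ring
  exact (hadd s).symm

theorem sum_prod_descFactorial_mul_prod_pow_ne_zero {τ : Type*} [Fintype τ]
    {s : Finset (τ →₀ ℕ)} {a : (τ →₀ ℕ) → ℂ}
    (h : ∀ x : τ → ℂ, (∀ i, x i = 0 ∨ 0 < (x i).im) → ∑ m ∈ s, a m * ∏ i, x i ^ m i ≠ 0)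
    (b : τ → ℕ) (J : Finset τ) (x : τ → ℂ) (hx : ∀ i, x i = 0 ∨ 0 < (x i).im) :
    ∑ m ∈ s, a m * (∏ j ∈ J, ((b j).descFactorial (m j) : ℂ)) * ∏ i, x i ^ m i ≠ 0 := by
  classical
  induction J using Finset.induction generalizing x with
  | empty => simpa using h x hx
  | insert j J hj ih =>
    have := sum_descFactorial_mul_prod_pow_ne_zero ih j (b j) x hx
    convert this using 3 with m
    rw [Finset.prod_insert hj]
    ring

open Filter Topology in
/-- A several-variable form of Hurwitz's theorem on the product of upper half-planes. -/
theorem ne_zero_or_eq_zero_of_tendstoUniformlyOn {τ : Type*} [Fintype τ]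
    {f : ℕ → (τ → ℂ) → ℂ} {g : (τ → ℂ) → ℂ} (hf : ∀ k, Differentiable ℂ (f k))
    (hg : Differentiable ℂ g) (hne : ∀ k x, (∀ i, 0 < (x i).im) → f k x ≠ 0)
    (hlim : ∀ K : Set (τ → ℂ), IsCompact K → TendstoUniformlyOn f g atTop K) :
    (∀ x, (∀ i, 0 < (x i).im) → g x ≠ 0) ∨ ∀ x, g x = 0 := by
  by_contra! hcon
  obtain ⟨⟨x, hx, hgx⟩, y, hgy⟩ := hcon
  set l : ℂ → τ → ℂ := fun s ↦ x + s • (y - x) with hl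
  have hldiff : Differentiable ℂ l := by fun_prop
  have hgl : Differentiable ℂ (g ∘ l) := hg.comp hldiff
  have hl0 : l 0 = x := by simp [hl]
  have hl1 : l 1 = y := by simp [hl]
  have hiso : ∀ᶠ s in 𝓝[≠] (0 : ℂ), (g ∘ l) s ≠ 0 := by
    have hA : AnalyticOnNhd ℂ (g ∘ l) Set.univ := fun s _ ↦ hgl.analyticAt s
    rcases (hA 0 trivial).eventually_eq_zero_or_eventually_ne_zero with h | h
    · have := hA.eqOn_zero_of_preconnected_of_eventuallyEq_zero isPreconnected_univ
        (Set.mem_univ 0) h (Set.mem_univ 1)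
      simp only [Function.comp_apply, hl1] at this
      exact absurd this hgy
    · exact h
  have hup : ∀ᶠ s in 𝓝 (0 : ℂ), ∀ i, 0 < (l s i).im := by
    rw [eventually_all]
    intro i
    have hc : Continuous fun s ↦ (l s i).im := by
      simp only [hl]
      fun_prop
    exact hc.continuousAt.eventually_const_lt (by simpa [hl0] using hx i)
  rw [eventually_nhdsWithin_iff] at hiso
  obtain ⟨ε, hε, hball⟩ := Metric.eventually_nhds_iff_ball.1 (hiso.and hup)
  set r := ε / 2 with hr
  have hr0 : 0 < r := by positivity
  have hcb : Metric.closedBall (0 : ℂ) r ⊆ Metric.ball 0 ε :=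
    Metric.closedBall_subset_ball (by linarith)
  have hK : IsCompact (l '' Metric.closedBall 0 r) :=
    (isCompact_closedBall 0 r).image hldiff.continuous
  have hsph : IsCompact (Metric.sphere (0 : ℂ) r) := isCompact_sphere 0 r
  have hsne : (Metric.sphere (0 : ℂ) r).Nonempty := NormedSpace.sphere_nonempty.2 hr0.le
  obtain ⟨s₀, hs₀, hmin⟩ := hsph.exists_isMinOn hsne hgl.continuous.norm.continuousOn
  set c := ‖(g ∘ l) s₀‖ with hc
  have hc0 : 0 < c := by
    refine norm_pos_iff.2 ((hball s₀ (hcb (Metric.sphere_subset_closedBall hs₀))).1 ?_)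
    rintro rfl
    simp [hr0.ne] at hs₀
  obtain ⟨k, hk⟩ := (Metric.tendstoUniformlyOn_iff.1 (hlim _ hK) (c / 2) (by positivity)).exists
  have hk' : ∀ s ∈ Metric.closedBall (0 : ℂ) r, ‖g (l s) - f k (l s)‖ < c / 2 := fun s hs ↦ by
    rw [← dist_eq_norm]
    exact hk _ ⟨s, hs, rfl⟩
  have hnz : ∀ s ∈ Metric.closedBall (0 : ℂ) r, f k (l s) ≠ 0 := fun s hs ↦
    hne k _ (hball s (hcb hs)).2
  have hd : DiffContOnCl ℂ (fun s ↦ (f k (l s))⁻¹) (Metric.ball 0 r) := by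
    apply DifferentiableOn.diffContOnCl
    rw [closure_ball _ hr0.ne']
    exact ((hf k).comp hldiff).differentiableOn.inv hnz
  have hmax := Complex.norm_le_of_forall_mem_frontier_norm_le Metric.isBounded_ball hd
    (C := 2 / c) (fun s hs ↦ by
      rw [frontier_ball _ hr0.ne'] at hs
      have h1 := hk' s (Metric.sphere_subset_closedBall hs)
      have h2 : c ≤ ‖g (l s)‖ := hmin hs
      have h3 := norm_sub_norm_le (g (l s)) (f k (l s))
      rw [norm_inv, inv_le_comm₀ (norm_pos_iff.2 (hnz s (Metric.sphere_subset_closedBall hs)))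
        (by positivity), inv_div]
      linarith) (subset_closure (Metric.mem_ball_self hr0))
  have h0 : (0 : ℂ) ∈ Metric.closedBall (0 : ℂ) r := Metric.mem_closedBall_self hr0.le
  have h1 := hk' 0 h0
  rw [hl0, hgx, zero_sub, norm_neg] at h1
  have h2 := hnz 0 h0
  rw [hl0] at h2
  rw [norm_inv, hl0, inv_le_comm₀ (norm_pos_iff.2 h2) (by positivity), inv_div] at hmax
  linarith

section TorusAverage

open MeasureTheory AddCircle

/-- The point of the unit torus in `ℂ^ι` with the given angles. -/
noncomputable def torusPoint {ι : Type*} (θ : ι → UnitAddCircle) (j : ι) : ℂ :=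
  fourier 1 (θ j)

/-- The kernel `∏ⱼ ∑_{a ≤ βⱼ} (βⱼ)_a (wⱼ / ζⱼ)^a` on the torus. -/
noncomputable def jensenKernel {ι : Type*} [Fintype ι] (β : ι → ℕ) (w : ι → ℂ)
    (θ : ι → UnitAddCircle) : ℂ :=
  ∏ j, ∑ a ∈ Finset.range (β j + 1),
    ((β j).descFactorial a : ℂ) * w j ^ a * fourier (-(a : ℤ)) (θ j)

/-- The average of `φ` over the unit torus against `jensenKernel β w`. -/
noncomputable def jensenAverage {ι : Type*} [Fintype ι] (β : ι → ℕ) (φ : (ι → ℂ) → ℂ)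
    (w : ι → ℂ) : ℂ :=
  ∫ θ, φ (torusPoint θ) * jensenKernel β w θ ∂(Measure.pi fun _ ↦ haarAddCircle)

theorem norm_torusPoint {ι : Type*} (θ : ι → UnitAddCircle) (j : ι) : ‖torusPoint θ j‖ = 1 := by
  rw [torusPoint, fourier_apply]
  exact Circle.norm_coe _

theorem continuous_torusPoint {ι : Type*} :
    Continuous (torusPoint : (ι → UnitAddCircle) → ι → ℂ) := by
  unfold torusPoint
  fun_prop

theorem continuous_jensenKernel {ι : Type*} [Fintype ι] (β : ι → ℕ) (w : ι → ℂ) :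
    Continuous (jensenKernel β w) := by
  unfold jensenKernel
  fun_prop

theorem norm_jensenKernel_le {ι : Type*} [Fintype ι] (β : ι → ℕ) (w : ι → ℂ)
    (θ : ι → UnitAddCircle) :
    ‖jensenKernel β w θ‖ ≤
      ∏ j, ∑ a ∈ Finset.range (β j + 1), ((β j).descFactorial a : ℝ) * ‖w j‖ ^ a := by
  rw [jensenKernel, norm_prod]
  refine Finset.prod_le_prod (fun _ _ ↦ norm_nonneg _) fun j _ ↦ ?_
  refine (norm_sum_le _ _).trans (Finset.sum_le_sum fun a _ ↦ ?_)
  rw [norm_mul, norm_mul, norm_pow, Complex.norm_natCast, fourier_apply, Circle.norm_coe, mul_one]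

theorem integrable_of_continuous_torus {ι : Type*} [Fintype ι] {f : (ι → UnitAddCircle) → ℂ}
    (hf : Continuous f) : Integrable f (Measure.pi fun _ ↦ haarAddCircle) :=
  hf.integrable_of_hasCompactSupport (HasCompactSupport.of_compactSpace f)

theorem integral_fourier_one_pow_mul_sum (m b : ℕ) (c : ℕ → ℂ) (hc : ∀ a, b < a → c a = 0) :
    ∫ θ : UnitAddCircle, (fourier 1 θ : ℂ) ^ m *
      ∑ a ∈ Finset.range (b + 1), c a * fourier (-(a : ℤ)) θ ∂haarAddCircle = c m := by
  have h1 : ∀ θ : UnitAddCircle, (fourier 1 θ : ℂ) ^ m *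
      ∑ a ∈ Finset.range (b + 1), c a * fourier (-(a : ℤ)) θ =
      ∑ a ∈ Finset.range (b + 1), c a * (fourier (-(a : ℤ)) θ • (fourier (m : ℤ) θ : ℂ)) := by
    intro θ
    have : (fourier 1 θ : ℂ) ^ m = fourier (m : ℤ) θ := by
      rw [fourier_apply, fourier_apply, ← Circle.coe_pow, one_zsmul, natCast_zsmul,
        AddCircle.toCircle_nsmul]
    rw [this, Finset.mul_sum]
    refine Finset.sum_congr rfl fun a _ ↦ ?_
    rw [smul_eq_mul]
    ring
  simp_rw [h1]
  rw [integral_finsetSum]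
  · have h2 : ∀ a : ℕ, ∫ θ : UnitAddCircle, c a * (fourier (-(a : ℤ)) θ • (fourier (m : ℤ) θ : ℂ))
        ∂haarAddCircle = if a = m then c m else 0 := by
      intro a
      rw [integral_const_mul]
      have := congrFun (fourierCoeff_fourier (T := 1) (m : ℤ)) (a : ℤ)
      rw [fourierCoeff] at this
      rw [this, Pi.single_apply]
      by_cases ham : a = m
      · simp [ham]
      · simp [ham]
    simp_rw [h2]
    rw [Finset.sum_ite_eq']
    split_ifs with h
    · rfl
    · exact (hc m (by simpa using h)).symm
  · intro a _
    apply Continuous.integrable_of_hasCompactSupport _ (HasCompactSupport.of_compactSpace _)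
    fun_prop

variable {ι : Type*} [Fintype ι]

theorem jensenAverage_prod_pow (β : ι → ℕ) (m : ι → ℕ) (w : ι → ℂ) :
    jensenAverage β (fun ζ ↦ ∏ j, ζ j ^ m j) w =
      ∏ j, (((β j).descFactorial (m j) : ℂ) * w j ^ m j) := by
  rw [jensenAverage]
  simp_rw [jensenKernel, torusPoint, ← Finset.prod_mul_distrib]
  rw [integral_fintype_prod_eq_prod (fun j (t : UnitAddCircle) ↦ (fourier 1 t : ℂ) ^ m j *
    ∑ a ∈ Finset.range (β j + 1),
      ((β j).descFactorial a : ℂ) * w j ^ a * fourier (-(a : ℤ)) t)]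
  refine Finset.prod_congr rfl fun j _ ↦ ?_
  exact integral_fourier_one_pow_mul_sum (m j) (β j)
    (fun a ↦ ((β j).descFactorial a : ℂ) * w j ^ a)
    (fun a ha ↦ by simp [Nat.descFactorial_of_lt ha])

theorem jensenAverage_const_mul (β : ι → ℕ) (c : ℂ) (φ : (ι → ℂ) → ℂ) (w : ι → ℂ) :
    jensenAverage β (fun ζ ↦ c * φ ζ) w = c * jensenAverage β φ w := by
  simp only [jensenAverage, mul_assoc]
  rw [integral_const_mul]

theorem jensenAverage_finsetSum {κ : Type*} (β : ι → ℕ) (s : Finset κ) (φ : κ → (ι → ℂ) → ℂ)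
    (hφ : ∀ k ∈ s, Continuous (φ k)) (w : ι → ℂ) :
    jensenAverage β (fun ζ ↦ ∑ k ∈ s, φ k ζ) w = ∑ k ∈ s, jensenAverage β (φ k) w := by
  simp only [jensenAverage, Finset.sum_mul]
  rw [integral_finsetSum]
  intro k hk
  exact integrable_of_continuous_torus
    (((hφ k hk).comp continuous_torusPoint).mul (continuous_jensenKernel β w))

theorem norm_jensenAverage_sub_le (β : ι → ℕ) {φ ψ : (ι → ℂ) → ℂ} (hφ : Continuous φ)
    (hψ : Continuous ψ) (w : ι → ℂ) {ε : ℝ} (hε : 0 ≤ ε)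
    (h : ∀ ζ : ι → ℂ, (∀ j, ‖ζ j‖ = 1) → ‖φ ζ - ψ ζ‖ ≤ ε) :
    ‖jensenAverage β φ w - jensenAverage β ψ w‖ ≤
      ε * ∏ j, ∑ a ∈ Finset.range (β j + 1), ((β j).descFactorial a : ℝ) * ‖w j‖ ^ a := by
  rw [jensenAverage, jensenAverage, ← integral_sub]
  · refine (norm_integral_le_of_norm_le_const (C := ε * ∏ j, ∑ a ∈ Finset.range (β j + 1),
      ((β j).descFactorial a : ℝ) * ‖w j‖ ^ a) (Filter.Eventually.of_forall fun θ ↦ ?_)).trans ?_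
    · rw [← sub_mul, norm_mul]
      exact mul_le_mul (h _ (norm_torusPoint θ)) (norm_jensenKernel_le β w θ) (norm_nonneg _) hε
    · simp
  · exact integrable_of_continuous_torus
      ((hφ.comp continuous_torusPoint).mul (continuous_jensenKernel β w))
  · exact integrable_of_continuous_torus
      ((hψ.comp continuous_torusPoint).mul (continuous_jensenKernel β w))

theorem jensenAverage_hasSum (β : ι → ℕ) {c : (ι →₀ ℕ) → ℂ} {φ : (ι → ℂ) → ℂ}
    (h : ∀ ζ : ι → ℂ, HasSum (fun α : ι →₀ ℕ ↦ c α * ∏ j, ζ j ^ α j) (φ ζ)) (w : ι → ℂ) :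
    HasSum (fun α : ι →₀ ℕ ↦ c α * ∏ j, (((β j).descFactorial (α j) : ℂ) * w j ^ α j))
      (jensenAverage β φ w) := by
  have hs : Summable fun α : ι →₀ ℕ ↦ ‖c α‖ := by
    have := (h 1).summable.norm
    simpa using this
  have hcont : ∀ α : ι →₀ ℕ, Continuous fun ζ : ι → ℂ ↦ c α * ∏ j, ζ j ^ α j := by
    intro α
    fun_prop
  have key := hasSum_integral_of_summable_integral_norm
    (μ := (Measure.pi fun _ : ι ↦ (haarAddCircle : Measure UnitAddCircle)))
    (F := fun (α : ι →₀ ℕ) θ ↦ (c α * ∏ j, torusPoint θ j ^ α j) * jensenKernel β w θ)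
    (fun α ↦ integrable_of_continuous_torus
      (((hcont α).comp continuous_torusPoint).mul (continuous_jensenKernel β w))) (by
      refine Summable.of_nonneg_of_le (fun α ↦ integral_nonneg fun θ ↦ norm_nonneg _)
        (fun α ↦ ?_) (hs.mul_right
          (∏ j, ∑ a ∈ Finset.range (β j + 1), ((β j).descFactorial a : ℝ) * ‖w j‖ ^ a))
      refine (integral_mono_of_nonneg (Filter.Eventually.of_forall fun θ ↦ norm_nonneg _)
        (integrable_const (‖c α‖ * ∏ j, ∑ a ∈ Finset.range (β j + 1),
          ((β j).descFactorial a : ℝ) * ‖w j‖ ^ a))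
        (Filter.Eventually.of_forall fun θ ↦ ?_)).trans (by simp)
      simp only [norm_mul, norm_prod, norm_pow, norm_torusPoint, one_pow, Finset.prod_const_one,
        mul_one]
      exact mul_le_mul_of_nonneg_left (norm_jensenKernel_le β w θ) (norm_nonneg _))
  have h1 : ∀ α : ι →₀ ℕ, ∫ θ, (c α * ∏ j, torusPoint θ j ^ α j) * jensenKernel β w θ
      ∂(Measure.pi fun _ ↦ haarAddCircle) =
      c α * ∏ j, (((β j).descFactorial (α j) : ℂ) * w j ^ α j) := by
    intro α
    rw [← jensenAverage_prod_pow, ← jensenAverage_const_mul]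
    rfl
  simp_rw [h1] at key
  have h2 : jensenAverage β φ w = ∫ θ, (∑' α : ι →₀ ℕ, (c α * ∏ j, torusPoint θ j ^ α j) *
      jensenKernel β w θ) ∂(Measure.pi fun _ ↦ haarAddCircle) := by
    refine integral_congr_ae (Filter.Eventually.of_forall fun θ ↦ ?_)
    simp only
    rw [tsum_mul_right, (h _).tsum_eq]
  rwa [h2]

end TorusAverage

section Forward

open Filter Topology

theorem eval_jensenTrunc {n : ℕ} (P : (Fin n →₀ ℕ) → MvPolynomial (Fin n) ℂ) (β : Fin n →₀ ℕ)
    (x : Fin n ⊕ Fin n → ℂ) :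
    eval x (jensenTrunc P β) = ∑ α ∈ Finset.Iic β, eval (x ∘ Sum.inl) (P α) *
      ∏ j, (((β j).descFactorial (α j) : ℂ) * x (Sum.inr j) ^ α j) := by
  rw [jensenTrunc, map_sum]
  refine Finset.sum_congr rfl fun α _ ↦ ?_
  rw [map_mul, map_mul, eval_C, eval_rename, eval_monomial,
    Finsupp.prod_mapDomain_index_inj Sum.inr_injective, Finsupp.prod_fintype _ _ (by simp),
    Finset.prod_mul_distrib]
  push_cast
  ring

theorem jensenAverage_eval {n : ℕ} (β : Fin n → ℕ) (g : MvPolynomial (Fin n ⊕ Fin n) ℂ)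
    (z w : Fin n → ℂ) :
    jensenAverage β (fun ζ ↦ eval (Sum.elim z ζ) g) w =
      ∑ m ∈ g.support, coeff m g *
        (∏ j ∈ Finset.univ.map Function.Embedding.inr,
          (((Sum.elim 0 β : Fin n ⊕ Fin n → ℕ) j).descFactorial (m j) : ℂ)) *
        ∏ i, (Sum.elim z w) i ^ m i := by
  simp_rw [eval_eq']
  rw [jensenAverage_finsetSum]
  · refine Finset.sum_congr rfl fun m _ ↦ ?_
    have h1 : ∀ ζ : Fin n → ℂ, coeff m g * ∏ i, (Sum.elim z ζ) i ^ m i =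
        (coeff m g * ∏ i, z i ^ m (Sum.inl i)) * ∏ j, ζ j ^ m (Sum.inr j) := by
      intro ζ
      rw [Fintype.prod_sum_type]
      simp [mul_assoc]
    simp_rw [h1]
    rw [jensenAverage_const_mul, jensenAverage_prod_pow β (fun j ↦ m (Sum.inr j)),
      Finset.prod_mul_distrib, Finset.prod_map, Fintype.prod_sum_type]
    simp only [Function.Embedding.inr_apply, Sum.elim_inr, Sum.elim_inl]
    ring
  · intro m _
    refine continuous_const.mul (continuous_finsetProd _ fun i _ ↦ ?_)
    rcases i with i | i
    · simp only [Sum.elim_inl]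
      fun_prop
    · simp only [Sum.elim_inr]
      fun_prop

theorem jensenAverage_eq_eval_jensenTrunc {n : ℕ} {P : (Fin n →₀ ℕ) → MvPolynomial (Fin n) ℂ}
    {F : (Fin n ⊕ Fin n → ℂ) → ℂ}
    (hF : ∀ zw : Fin n ⊕ Fin n → ℂ, HasSum (fun α : Fin n →₀ ℕ ↦
      eval (zw ∘ Sum.inl) (P α) * ∏ i, zw (Sum.inr i) ^ α i) (F zw))
    (β : Fin n →₀ ℕ) (z w : Fin n → ℂ) :
    jensenAverage β (fun ζ ↦ F (Sum.elim z ζ)) w = eval (Sum.elim z w) (jensenTrunc P β) := by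
  have h := jensenAverage_hasSum β (c := fun α ↦ eval z (P α))
    (φ := fun ζ ↦ F (Sum.elim z ζ)) (fun ζ ↦ by simpa using hF (Sum.elim z ζ)) w
  rw [eval_jensenTrunc]
  refine h.unique ?_
  simp only [Sum.elim_comp_inl, Sum.elim_inr]
  refine hasSum_sum_of_ne_finset_zero fun α hα ↦ ?_
  have : ∃ j, β j < α j := by
    by_contra! hcon
    exact hα (Finset.mem_Iic.2 hcon)
  obtain ⟨j, hj⟩ := this
  rw [Finset.prod_eq_zero (Finset.mem_univ j) (by simp [Nat.descFactorial_of_lt hj]), mul_zero]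

theorem tendstoUniformlyOn_comp_add_smul {E : Type*} [NormedAddCommGroup E] [NormedSpace ℝ E]
    {f : ℕ → E → ℂ} {F : E → ℂ} (hF : Continuous F)
    (hlim : ∀ K : Set E, IsCompact K → TendstoUniformlyOn f F atTop K) (v : E)
    {K : Set E} (hK : IsCompact K) :
    TendstoUniformlyOn (fun k x ↦ f k (x + (1 / ((k : ℝ) + 1)) • v)) F atTop K := by
  set φ : E × ℝ → E := fun p ↦ p.1 + p.2 • v with hφ
  have hφc : Continuous φ := by fun_prop
  have hK' : IsCompact (φ '' (K ×ˢ Set.Icc 0 1)) := (hK.prod isCompact_Icc).image hφc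
  have hu : TendstoUniformlyOn (fun (k : ℕ) x ↦ F (x + (1 / ((k : ℝ) + 1)) • v)) F atTop K := by
    have huc := (hK.prod (isCompact_Icc (a := (0 : ℝ)) (b := 1))).uniformContinuousOn_of_continuous
      (hF.comp hφc).continuousOn
    rw [Metric.uniformContinuousOn_iff] at huc
    rw [Metric.tendstoUniformlyOn_iff]
    intro ε hε
    obtain ⟨δ, hδ, h⟩ := huc ε hε
    have ht := tendsto_one_div_add_atTop_nhds_zero_nat (𝕜 := ℝ)
    filter_upwards [ht.eventually_lt_const hδ] with k hk x hx
    have h0 : (0 : ℝ) ≤ 1 / ((k : ℝ) + 1) := by positivity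
    have := h (x, 0) ⟨hx, by simp⟩ (x, 1 / ((k : ℝ) + 1)) ⟨hx, h0, by
      rw [div_le_one (by positivity)]; simp⟩ (by
        rw [Prod.dist_eq, dist_self, Real.dist_eq, zero_sub, abs_neg, abs_of_nonneg h0]
        exact max_lt hδ hk)
    simpa [hφ] using this
  rw [Metric.tendstoUniformlyOn_iff] at hu ⊢
  intro ε hε
  filter_upwards [hu (ε / 2) (by positivity),
    Metric.tendstoUniformlyOn_iff.1 (hlim _ hK') (ε / 2) (by positivity)] with k h1 h2 x hx
  have h3 := h2 (x + (1 / ((k : ℝ) + 1)) • v) ⟨(x, 1 / ((k : ℝ) + 1)), ⟨hx, by positivity, by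
      rw [div_le_one (by positivity)]; simp⟩, rfl⟩
  calc _ ≤ _ := dist_triangle _ _ _
    _ < ε / 2 + ε / 2 := add_lt_add (h1 x hx) h3
    _ = ε := add_halves ε

theorem isStable_jensenTrunc_or_eq_zero {n : ℕ} {P : (Fin n →₀ ℕ) → MvPolynomial (Fin n) ℂ}
    {F : (Fin n ⊕ Fin n → ℂ) → ℂ}
    (hF : ∀ zw : Fin n ⊕ Fin n → ℂ, HasSum (fun α : Fin n →₀ ℕ ↦
      eval (zw ∘ Sum.inl) (P α) * ∏ i, zw (Sum.inr i) ^ α i) (F zw))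
    {g : ℕ → MvPolynomial (Fin n ⊕ Fin n) ℂ} (hg : ∀ k, IsStable (g k))
    (hlim : ∀ K : Set (Fin n ⊕ Fin n → ℂ), IsCompact K →
      TendstoUniformlyOn (fun k zw ↦ eval zw (g k)) F atTop K) (β : Fin n →₀ ℕ) :
    IsStable (jensenTrunc P β) ∨ jensenTrunc P β = 0 := by
  have hFc : Continuous F :=
    (tendstoLocallyUniformly_iff_forall_isCompact.2 hlim).continuous
      (Frequently.of_forall fun k ↦ (g k).continuous_eval)
  set h : ℕ → MvPolynomial (Fin n ⊕ Fin n) ℂ := fun k ↦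
    bind₁ (fun i ↦ X i + C ((1 / ((k : ℝ) + 1) : ℝ) • Complex.I)) (g k) with hh
  have heval : ∀ k x, eval x (h k) = eval (x + (1 / ((k : ℝ) + 1)) • fun _ ↦ Complex.I) (g k) := by
    intro k x
    rw [hh, ← coe_aeval_eq_eval, ← coe_aeval_eq_eval]
    simp only [RingHom.coe_coe]
    rw [aeval_bind₁]
    congr 2
    ext i
    simp
  have hlim' : ∀ K : Set (Fin n ⊕ Fin n → ℂ), IsCompact K →
      TendstoUniformlyOn (fun k zw ↦ eval zw (h k)) F atTop K := by
    intro K hK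
    have := tendstoUniformlyOn_comp_add_smul hFc hlim (fun _ ↦ Complex.I) hK
    simpa only [← heval] using this
  have hne : ∀ k x, (∀ i, x i = 0 ∨ 0 < (x i).im) → eval x (h k) ≠ 0 := by
    intro k x hx
    rw [heval]
    apply hg k
    intro i
    have hk : (0 : ℝ) < 1 / ((k : ℝ) + 1) := by positivity
    have : 0 ≤ (x i).im := by
      rcases hx i with h | h
      · simp [h]
      · exact h.le
    rw [Pi.add_apply, Pi.smul_apply, Complex.add_im, Complex.smul_im, Complex.I_im, smul_eq_mul,
      mul_one]
    linarith
  set f : ℕ → (Fin n ⊕ Fin n → ℂ) → ℂ := fun k x ↦ ∑ m ∈ (h k).support, coeff m (h k) *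
        (∏ j ∈ Finset.univ.map Function.Embedding.inr,
          (((Sum.elim 0 β : Fin n ⊕ Fin n → ℕ) j).descFactorial (m j) : ℂ)) *
        ∏ i, x i ^ m i with hf
  have hfJ : ∀ k x, f k x =
      jensenAverage β (fun ζ ↦ eval (Sum.elim (x ∘ Sum.inl) ζ) (h k)) (x ∘ Sum.inr) := by
    intro k x
    rw [jensenAverage_eval, hf]
    simp
  have hfne : ∀ k x, (∀ i, 0 < (x i).im) → f k x ≠ 0 := fun k x hx ↦
    sum_prod_descFactorial_mul_prod_pow_ne_zero
      (fun x hx ↦ by simpa only [eval_eq'] using hne k x hx) _ _ x (fun i ↦ Or.inr (hx i))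
  have hPJ : ∀ x, eval x (jensenTrunc P β) =
      jensenAverage β (fun ζ ↦ F (Sum.elim (x ∘ Sum.inl) ζ)) (x ∘ Sum.inr) := by
    intro x
    rw [jensenAverage_eq_eval_jensenTrunc hF, Sum.elim_comp_inl_inr]
  have hcelim : Continuous fun p : (Fin n ⊕ Fin n → ℂ) × (Fin n → ℂ) ↦
      (Sum.elim (p.1 ∘ Sum.inl) p.2 : Fin n ⊕ Fin n → ℂ) := by
    refine continuous_pi fun i ↦ ?_
    rcases i with i | i
    · simp only [Sum.elim_inl, Function.comp_apply]
      fun_prop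
    · simp only [Sum.elim_inr]
      fun_prop
  have hlimf : ∀ K : Set (Fin n ⊕ Fin n → ℂ), IsCompact K →
      TendstoUniformlyOn f (fun x ↦ eval x (jensenTrunc P β)) atTop K := by
    intro K hK
    have hT : IsCompact (Set.pi Set.univ fun _ : Fin n ↦ Metric.sphere (0 : ℂ) 1) :=
      isCompact_univ_pi fun _ ↦ isCompact_sphere 0 1
    have hK' := (hK.prod hT).image hcelim
    have hbc : Continuous fun x : Fin n ⊕ Fin n → ℂ ↦
        ∏ j, ∑ a ∈ Finset.range (β j + 1),
          ((β j).descFactorial a : ℝ) * ‖(x ∘ Sum.inr) j‖ ^ a := by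
      simp only [Function.comp_apply]
      fun_prop
    obtain ⟨B, hB⟩ := (hK.bddAbove_image hbc.continuousOn)
    have hB' : ∀ x ∈ K, ∏ j, ∑ a ∈ Finset.range (β j + 1),
          ((β j).descFactorial a : ℝ) * ‖(x ∘ Sum.inr) j‖ ^ a ≤ |B| := fun x hx ↦
      (hB ⟨x, hx, rfl⟩).trans (le_abs_self B)
    rw [Metric.tendstoUniformlyOn_iff]
    intro ε hε
    filter_upwards [Metric.tendstoUniformlyOn_iff.1 (hlim' _ hK') (ε / (|B| + 1))
      (by positivity)] with k hk x hx
    rw [hPJ, hfJ, dist_eq_norm]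
    have hel : Continuous fun ζ : Fin n → ℂ ↦
        (Sum.elim (x ∘ Sum.inl) ζ : Fin n ⊕ Fin n → ℂ) :=
      hcelim.comp (Continuous.prodMk_right x)
    have := norm_jensenAverage_sub_le β (φ := fun ζ ↦ F (Sum.elim (x ∘ Sum.inl) ζ))
      (ψ := fun ζ ↦ eval (Sum.elim (x ∘ Sum.inl) ζ) (h k)) (hFc.comp hel)
      ((h k).continuous_eval.comp hel) (x ∘ Sum.inr) (ε := ε / (|B| + 1)) (by positivity)
      (fun ζ hζ ↦ by
        rw [← dist_eq_norm]
        exact (hk _ ⟨(x, ζ), ⟨hx, fun j _ ↦ by simpa using hζ j⟩, rfl⟩).le)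
    refine this.trans_lt ?_
    calc _ ≤ ε / (|B| + 1) * |B| := mul_le_mul_of_nonneg_left (hB' x hx) (by positivity)
      _ < ε := by
        rw [div_mul_eq_mul_div, div_lt_iff₀ (by positivity)]
        nlinarith
  have hdiff : ∀ p : MvPolynomial (Fin n ⊕ Fin n) ℂ, Differentiable ℂ fun x ↦ eval x p := by
    intro p
    simp only [eval_eq']
    fun_prop
  rcases ne_zero_or_eq_zero_of_tendstoUniformlyOn (f := f) (fun k ↦ by rw [hf]; fun_prop)
    (hdiff (jensenTrunc P β)) hfne hlimf with h | h
  · exact Or.inl h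
  · exact Or.inr (MvPolynomial.funext fun x ↦ by simpa using h x)

end Forward

namespace Polynomial

theorem coeff_prod_one_sub_C_mul_X (s : Multiset ℂ) :
    ((s.map fun a ↦ (1 - C a * X : ℂ[X])).prod.coeff 0 = 1) ∧
    ((s.map fun a ↦ (1 - C a * X : ℂ[X])).prod.coeff 1 = -s.sum) ∧
    (2 * (s.map fun a ↦ (1 - C a * X : ℂ[X])).prod.coeff 2 =
      s.sum ^ 2 - (s.map fun a ↦ a ^ 2).sum) := by
  induction s using Multiset.induction with
  | empty => simp [coeff_one]
  | cons a s ih =>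
    obtain ⟨h0, h1, h2⟩ := ih
    simp only [Multiset.map_cons, Multiset.prod_cons, Multiset.sum_cons, sub_mul, one_mul,
      coeff_sub, mul_assoc, coeff_C_mul, coeff_X_mul, coeff_X_mul_zero, h0]
    refine ⟨by simp, ?_, ?_⟩
    · rw [h1]
      ring
    · rw [h1, mul_sub, h2]
      ring

theorem norm_sq_eval_prod_one_sub_le (s : Multiset ℂ) (t : ℂ) :
    ‖(s.map fun a ↦ (1 - C a * X : ℂ[X])).prod.eval t‖ ^ 2 ≤
      Real.exp (-2 * (s.sum * t).re + ‖t‖ ^ 2 * (s.map fun a ↦ ‖a‖ ^ 2).sum) := by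
  induction s using Multiset.induction with
  | empty => simp
  | cons a s ih =>
    simp only [Multiset.map_cons, Multiset.prod_cons, Multiset.sum_cons, eval_mul, norm_mul,
      mul_pow]
    have h1 : ‖(1 - C a * X : ℂ[X]).eval t‖ ^ 2 ≤
        Real.exp (-2 * (a * t).re + ‖t‖ ^ 2 * ‖a‖ ^ 2) := by
      have : ‖(1 - C a * X : ℂ[X]).eval t‖ ^ 2 =
          (-2 * (a * t).re + ‖t‖ ^ 2 * ‖a‖ ^ 2) + 1 := by
        rw [← mul_pow, mul_comm ‖t‖, ← norm_mul]
        simp only [eval_sub, eval_one, eval_mul, eval_C, eval_X]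
        rw [← Complex.normSq_eq_norm_sq, ← Complex.normSq_eq_norm_sq, Complex.normSq_sub]
        simp
        ring
      rw [this]
      exact Real.add_one_le_exp _
    calc _ ≤ _ := mul_le_mul h1 ih (by positivity) (by positivity)
      _ = _ := by
        rw [← Real.exp_add]
        congr 1
        rw [add_mul, Complex.add_re]
        ring

theorem sum_norm_sq_le (s : Multiset ℂ) (hs : ∀ a ∈ s, 0 ≤ a.im) :
    (s.map fun a ↦ ‖a‖ ^ 2).sum ≤ ((s.map fun a ↦ a ^ 2).sum).re + 2 * s.sum.im ^ 2 := by
  suffices h : 0 ≤ s.sum.im ∧ (s.map fun a ↦ ‖a‖ ^ 2).sum ≤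
      ((s.map fun a ↦ a ^ 2).sum).re + 2 * s.sum.im ^ 2 from h.2
  induction s using Multiset.induction with
  | empty => simp
  | cons a s ih =>
    obtain ⟨h0, h1⟩ := ih fun r hr ↦ hs r (Multiset.mem_cons_of_mem hr)
    have ha := hs a (by simp)
    simp only [Multiset.map_cons, Multiset.sum_cons, Complex.add_re, Complex.add_im]
    refine ⟨by positivity, ?_⟩
    have h2 : ‖a‖ ^ 2 = (a ^ 2).re + 2 * a.im ^ 2 := by
      rw [← Complex.normSq_eq_norm_sq, Complex.normSq_apply, pow_two a, Complex.mul_re]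
      ring
    have := mul_nonneg ha h0
    rw [h2]
    nlinarith

theorem norm_eval_prod_one_sub_le (s : Multiset ℂ) (hs : ∀ a ∈ s, 0 ≤ a.im) (t : ℂ) :
    ‖(s.map fun a ↦ (1 - C a * X : ℂ[X])).prod.eval t‖ ≤
      Real.exp (‖(s.map fun a ↦ (1 - C a * X : ℂ[X])).prod.coeff 1‖ * ‖t‖ +
        (3 * ‖(s.map fun a ↦ (1 - C a * X : ℂ[X])).prod.coeff 1‖ ^ 2 +
          2 * ‖(s.map fun a ↦ (1 - C a * X : ℂ[X])).prod.coeff 2‖) / 2 * ‖t‖ ^ 2) := by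
  obtain ⟨-, h1, h2⟩ := coeff_prod_one_sub_C_mul_X s
  set p := (s.map fun a ↦ (1 - C a * X : ℂ[X])).prod with hp
  have h3 := norm_sq_eval_prod_one_sub_le s t
  have h4 := sum_norm_sq_le s hs
  rw [← hp] at h3
  refine le_of_sq_le_sq ?_ (Real.exp_pos _).le
  refine h3.trans ?_
  rw [← Real.exp_nat_mul, Real.exp_le_exp]
  have h5 : -(s.sum * t).re ≤ ‖p.coeff 1‖ * ‖t‖ := by
    rw [h1, norm_neg, ← norm_mul]
    exact (neg_le_abs _).trans (Complex.abs_re_le_norm _)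
  have h6 : ((s.map fun a ↦ a ^ 2).sum).re ≤ ‖p.coeff 1‖ ^ 2 + 2 * ‖p.coeff 2‖ := by
    have : (s.map fun a ↦ a ^ 2).sum = p.coeff 1 ^ 2 - 2 * p.coeff 2 := by
      rw [h1]
      linear_combination h2
    rw [this]
    refine (Complex.re_le_norm _).trans ((norm_sub_le _ _).trans ?_)
    simp
  have h7 : s.sum.im ^ 2 ≤ ‖p.coeff 1‖ ^ 2 := by
    rw [h1, norm_neg, ← sq_abs]
    gcongr
    exact Complex.abs_im_le_norm _
  have h8 : (s.map fun a ↦ ‖a‖ ^ 2).sum ≤ 3 * ‖p.coeff 1‖ ^ 2 + 2 * ‖p.coeff 2‖ := by linarith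
  have h9 := mul_le_mul_of_nonneg_left h8 (sq_nonneg ‖t‖)
  push_cast
  linarith

theorem deriv_iterate_eval (p : ℂ[X]) (d : ℕ) :
    deriv^[d] (fun t ↦ p.eval t) = fun t ↦ (derivative^[d] p).eval t := by
  induction d with
  | zero => rfl
  | succ d ih =>
    rw [Function.iterate_succ_apply', ih, Function.iterate_succ_apply']
    ext t
    exact Polynomial.deriv _

theorem norm_coeff_mul_pow_le (p : ℂ[X]) (d : ℕ) {r M : ℝ} (hr : 0 < r)
    (h : ∀ t : ℂ, ‖t‖ = r → ‖p.eval t‖ ≤ M) : ‖p.coeff d‖ * r ^ d ≤ M := by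
  have h1 := Complex.norm_iteratedDeriv_le_of_forall_mem_sphere_norm_le (f := fun t ↦ p.eval t)
    (c := 0) d hr (p.differentiable.diffContOnCl) (fun z hz ↦ h z (by simpa using hz))
  rw [iteratedDeriv_eq_iterate, deriv_iterate_eval] at h1
  simp only at h1
  rw [← coeff_zero_eq_eval_zero, coeff_iterate_derivative, zero_add, Nat.descFactorial_self,
    nsmul_eq_mul, norm_mul, Complex.norm_natCast, mul_div_assoc] at h1
  have := le_of_mul_le_mul_left h1 (by positivity)
  rwa [le_div_iff₀ (by positivity)] at this

/-- Szász's inequality for the coefficients of a polynomial without zeros in the upper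
half-plane. -/
theorem norm_coeff_add_mul_pow_le {q : ℂ[X]} {m : ℕ} (hlow : ∀ j < m, q.coeff j = 0)
    (hm : q.coeff m ≠ 0) (hq : ∀ t : ℂ, 0 < t.im → q.eval t ≠ 0) (d : ℕ) {r : ℝ} (hr : 0 < r) :
    ‖q.coeff (m + d)‖ * r ^ d ≤ ‖q.coeff m‖ *
      Real.exp (‖q.coeff (m + 1)‖ / ‖q.coeff m‖ * r +
        (3 * (‖q.coeff (m + 1)‖ / ‖q.coeff m‖) ^ 2 +
          2 * (‖q.coeff (m + 2)‖ / ‖q.coeff m‖)) / 2 * r ^ 2) := by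
  obtain ⟨p, rfl⟩ := X_pow_dvd_iff.2 hlow
  have hc : ∀ d, (X ^ m * p).coeff (m + d) = p.coeff d := fun d ↦ by
    rw [add_comm, coeff_X_pow_mul]
  have hc0 : (X ^ m * p).coeff m = p.coeff 0 := hc 0
  rw [hc0] at hm
  simp only [hc, hc0]
  have hp0 : p ≠ 0 := fun h ↦ hm (by simp [h])
  set s := p.roots.map (fun z ↦ z⁻¹) with hs
  have hr0 : ∀ z ∈ p.roots, z ≠ 0 := by
    rintro z hz rfl
    exact hm (by rw [coeff_zero_eq_eval_zero]; exact isRoot_of_mem_roots hz)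
  have hsim : ∀ a ∈ s, 0 ≤ a.im := by
    intro a ha
    obtain ⟨z, hz, rfl⟩ := Multiset.mem_map.1 ha
    rw [Complex.inv_im]
    refine div_nonneg ?_ (Complex.normSq_nonneg z)
    by_contra! hlt
    refine hq z (by linarith) ?_
    rw [eval_mul, show p.eval z = 0 from isRoot_of_mem_roots hz, mul_zero]
  have hprod : ∀ u : Multiset ℂ, (∀ z ∈ u, z ≠ 0) → ∃ c : ℂ,
      (u.map fun z ↦ X - C z).prod =
        C c * ((u.map fun z ↦ z⁻¹).map fun a ↦ (1 - C a * X : ℂ[X])).prod := by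
    intro u
    induction u using Multiset.induction with
    | empty => exact fun _ ↦ ⟨1, by simp⟩
    | cons a u ih =>
      intro hu
      obtain ⟨c, hc⟩ := ih fun z hz ↦ hu z (Multiset.mem_cons_of_mem hz)
      refine ⟨-a * c, ?_⟩
      simp only [Multiset.map_cons, Multiset.prod_cons, hc]
      have ha : C a * C a⁻¹ = (1 : ℂ[X]) := by
        rw [← C_mul, mul_inv_cancel₀ (hu a (by simp)), C_1]
      rw [C_mul, C_neg]
      generalize (Multiset.map (fun a ↦ (1 - C a * X : ℂ[X])) (u.map fun z ↦ z⁻¹)).prod = R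
      linear_combination (-X * C c * R) * ha
  obtain ⟨c, hcp⟩ := hprod p.roots hr0
  set P := (s.map fun a ↦ (1 - C a * X : ℂ[X])).prod with hP
  have hpP : p = C (p.leadingCoeff * c) * P := by
    conv_lhs => rw [(IsAlgClosed.splits p).eq_prod_roots, hcp]
    rw [C_mul, mul_assoc]
  have hP0 : P.coeff 0 = 1 := (coeff_prod_one_sub_C_mul_X s).1
  have hcc : p.leadingCoeff * c = p.coeff 0 := by
    conv_rhs => rw [hpP, coeff_C_mul, hP0, mul_one]
  rw [hcc] at hpP
  have hcoef : ∀ j, ‖p.coeff j‖ = ‖p.coeff 0‖ * ‖P.coeff j‖ := fun j ↦ by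
    conv_lhs => rw [hpP, coeff_C_mul, norm_mul]
  have hpos : 0 < ‖p.coeff 0‖ := norm_pos_iff.2 hm
  have hdiv : ∀ j, ‖p.coeff j‖ / ‖p.coeff 0‖ = ‖P.coeff j‖ := fun j ↦ by
    rw [hcoef, mul_div_cancel_left₀ _ hpos.ne']
  rw [hdiv, hdiv, hcoef d, mul_assoc]
  refine mul_le_mul_of_nonneg_left ?_ hpos.le
  refine P.norm_coeff_mul_pow_le d hr fun t ht ↦ ?_
  rw [← ht]
  exact norm_eval_prod_one_sub_le s hsim t

end Polynomial

section FiniteDifference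

open Finset

theorem sum_alternating_choose_mul_pow {m k : ℕ} (hk : k ≤ m) (y h : ℂ) :
    ∑ i ∈ range (m + 1), (-1 : ℂ) ^ (m - i) * m.choose i * (y + i * h) ^ k =
      if k = m then (m.factorial : ℂ) * h ^ m else 0 := by
  rcases Nat.eq_zero_or_pos m with rfl | hm
  · obtain rfl : k = 0 := by omega
    simp
  by_cases hh : h = 0
  · subst hh
    have h1 := Int.alternating_sum_range_choose_of_ne hm.ne'
    have h2 : ∑ i ∈ range (m + 1), (-1 : ℂ) ^ (m - i) * m.choose i = 0 := by
      rw [← sum_range_reflect]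
      have := congrArg (Int.cast (R := ℂ)) h1
      push_cast at this
      rw [← this]
      refine sum_congr rfl fun i hi ↦ ?_
      have hi' : i ≤ m := by simpa [Nat.lt_succ_iff] using hi
      rw [show m + 1 - 1 - i = m - i by omega, Nat.sub_sub_self hi', Nat.choose_symm hi']
    simp only [mul_zero, add_zero, ← sum_mul, h2, zero_mul, zero_pow hm.ne', mul_zero, ite_self]
  · have key : ∑ i ∈ range (m + 1), (-1 : ℂ) ^ (m - i) * m.choose i * (y + i * h) ^ k =
        h ^ k * (fwdDiff 1)^[m] (fun r : ℂ ↦ r ^ k) (y / h) := by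
      rw [fwdDiff_iter_eq_sum_shift, mul_sum]
      refine sum_congr rfl fun i _ ↦ ?_
      have : y + i * h = h * (y / h + i • 1) := by
        rw [nsmul_eq_mul, mul_one]
        field_simp
      rw [this, mul_pow, zsmul_eq_mul]
      push_cast
      ring
    rw [key]
    split_ifs with hkm
    · subst hkm
      rw [fwdDiff_iter_eq_factorial]
      simp [mul_comm]
    · rw [fwdDiff_iter_pow_eq_zero_of_lt (lt_of_le_of_ne hk hkm)]
      simp

variable {τ : Type*} [Fintype τ]

/-- A mixed finite difference extracts a coefficient of a homogeneous polynomial. -/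
theorem coeff_bound_of_bound_on_box [DecidableEq τ] {d : ℕ} (a : (τ →₀ ℕ) → ℂ)
    {y : τ → ℝ} {δ M : ℝ} (hδ : 0 ≤ δ)
    (hM : ∀ x : τ → ℝ, (∀ i, y i ≤ x i ∧ x i ≤ y i + δ) →
      ‖∑ m ∈ finsuppAntidiag univ d, a m * ∏ i, (x i : ℂ) ^ m i‖ ≤ M)
    {m : τ →₀ ℕ} (hm : m ∈ finsuppAntidiag univ d) :
    ‖a m‖ * ∏ i, ((m i).factorial * (δ / m i) ^ m i) ≤ 2 ^ d * M := by
  set h : τ → ℝ := fun i ↦ δ / m i with hh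
  have hsum : ∀ m' ∈ finsuppAntidiag (univ : Finset τ) d, ∑ i, m' i = d := fun m' hm' ↦
    (mem_finsuppAntidiag.1 hm').1
  set c : (τ → ℕ) → ℂ := fun κ ↦ ∏ i, (-1 : ℂ) ^ (m i - κ i) * (m i).choose (κ i) with hc
  have key : ∑ κ ∈ Fintype.piFinset fun i ↦ range (m i + 1), c κ *
      ∑ m' ∈ finsuppAntidiag univ d, a m' * ∏ i, ((y i + κ i * h i : ℝ) : ℂ) ^ m' i =
      a m * ∏ i, ((m i).factorial * (h i : ℂ) ^ m i) := by
    simp_rw [mul_sum]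
    rw [sum_comm, sum_eq_single_of_mem m hm]
    · have : ∀ κ : τ → ℕ, c κ * (a m * ∏ i, ((y i + κ i * h i : ℝ) : ℂ) ^ m i) =
          a m * ∏ i, ((-1 : ℂ) ^ (m i - κ i) * (m i).choose (κ i) *
            ((y i : ℂ) + κ i * (h i : ℂ)) ^ m i) := by
        intro κ
        rw [prod_mul_distrib (g := fun i ↦ ((y i : ℂ) + κ i * (h i : ℂ)) ^ m i)]
        push_cast
        ring
      simp_rw [this]
      rw [← mul_sum, ← prod_univ_sum (t := fun i ↦ range (m i + 1))
        (f := fun i k ↦ (-1 : ℂ) ^ (m i - k) * (m i).choose k *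
            ((y i : ℂ) + k * (h i : ℂ)) ^ m i)]
      congr 1
      refine prod_congr rfl fun i _ ↦ ?_
      rw [sum_alternating_choose_mul_pow le_rfl, if_pos rfl]
    · intro m' hm' hne
      have : ∀ κ : τ → ℕ, c κ * (a m' * ∏ i, ((y i + κ i * h i : ℝ) : ℂ) ^ m' i) =
          a m' * ∏ i, ((-1 : ℂ) ^ (m i - κ i) * (m i).choose (κ i) *
            ((y i : ℂ) + κ i * (h i : ℂ)) ^ m' i) := by
        intro κ
        rw [prod_mul_distrib (g := fun i ↦ ((y i : ℂ) + κ i * (h i : ℂ)) ^ m' i)]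
        push_cast
        ring
      simp_rw [this]
      rw [← mul_sum, ← prod_univ_sum (t := fun i ↦ range (m i + 1))
        (f := fun i k ↦ (-1 : ℂ) ^ (m i - k) * (m i).choose k *
            ((y i : ℂ) + k * (h i : ℂ)) ^ m' i)]
      have hlt : ∃ i, m' i < m i := by
        by_contra! hcon
        have h1 := hsum m hm
        have h2 := hsum m' hm'
        refine hne (Finsupp.ext fun i ↦ ?_)
        exact ((sum_eq_sum_iff_of_le fun i _ ↦ hcon i).1 (h1.trans h2.symm) i
          (mem_univ i)).symm
      obtain ⟨i, hi⟩ := hlt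
      rw [prod_eq_zero (mem_univ i), mul_zero]
      rw [sum_alternating_choose_mul_pow hi.le, if_neg hi.ne]
  have hnorm := congrArg norm key
  have hr : ‖a m * ∏ i, ((m i).factorial * (h i : ℂ) ^ m i)‖ =
      ‖a m‖ * ∏ i, ((m i).factorial * (δ / m i) ^ m i) := by
    rw [norm_mul, norm_prod]
    congr 1
    refine prod_congr rfl fun i _ ↦ ?_
    rw [norm_mul, norm_pow, Complex.norm_natCast, Complex.norm_real, Real.norm_of_nonneg]
    positivity
  rw [hr] at hnorm
  rw [← hnorm]
  refine (norm_sum_le _ _).trans ?_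
  have hcs : ∑ κ ∈ Fintype.piFinset fun i ↦ range (m i + 1), ‖c κ‖ = 2 ^ d := by
    simp only [hc, norm_prod, norm_mul, norm_pow, norm_neg, norm_one, one_pow, one_mul,
      Complex.norm_natCast]
    rw [← prod_univ_sum (t := fun i ↦ range (m i + 1)) (f := fun i k ↦ ((m i).choose k : ℝ)),
      ← hsum m hm, ← prod_pow_eq_pow_sum]
    refine prod_congr rfl fun i _ ↦ ?_
    exact_mod_cast Nat.sum_range_choose (m i)
  rw [← hcs, sum_mul]
  refine sum_le_sum fun κ hκ ↦ ?_
  rw [norm_mul]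
  refine mul_le_mul_of_nonneg_left (hM _ fun i ↦ ?_) (norm_nonneg _)
  have hκi : κ i ≤ m i := by
    have := Fintype.mem_piFinset.1 hκ i
    simpa [Nat.lt_succ_iff] using this
  constructor
  · simp only [hh, le_add_iff_nonneg_right]
    positivity
  · simp only [hh]
    have : (κ i : ℝ) * (δ / m i) ≤ δ := by
      rcases Nat.eq_zero_or_pos (m i) with h0 | h0
      · simp [h0, hδ]
      · rw [mul_div_assoc', div_le_iff₀ (by positivity), mul_comm]
        exact mul_le_mul_of_nonneg_left (by exact_mod_cast hκi) hδ
    linarith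

theorem inv_exp_mul_pow_le_factorial_mul (k : ℕ) {δ : ℝ} (hδ : 0 ≤ δ) :
    (δ / Real.exp 1) ^ k ≤ k.factorial * (δ / k) ^ k := by
  rcases Nat.eq_zero_or_pos k with rfl | hk
  · simp
  have h1 := Real.pow_div_factorial_le_exp (k : ℝ) (Nat.cast_nonneg k) k
  rw [div_le_iff₀ (by positivity), ← mul_one (k : ℝ), Real.exp_nat_mul, mul_one] at h1
  rw [div_pow, div_pow, mul_div_assoc', div_le_div_iff₀ (by positivity) (by positivity)]
  calc δ ^ k * (k : ℝ) ^ k ≤ δ ^ k * (Real.exp 1 ^ k * k.factorial) :=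
        mul_le_mul_of_nonneg_left h1 (by positivity)
    _ = _ := by ring

theorem norm_coeff_le_of_bound_on_box [DecidableEq τ] {d : ℕ} (a : (τ →₀ ℕ) → ℂ)
    {y : τ → ℝ} {δ M : ℝ} (hδ : 0 < δ)
    (hM : ∀ x : τ → ℝ, (∀ i, y i ≤ x i ∧ x i ≤ y i + δ) →
      ‖∑ m ∈ finsuppAntidiag univ d, a m * ∏ i, (x i : ℂ) ^ m i‖ ≤ M)
    {m : τ →₀ ℕ} (hm : m ∈ finsuppAntidiag univ d) :
    ‖a m‖ ≤ (2 * Real.exp 1 / δ) ^ d * M := by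
  have h1 := coeff_bound_of_bound_on_box a hδ.le hM hm
  have h2 : (δ / Real.exp 1) ^ d ≤ ∏ i, ((m i).factorial * (δ / m i) ^ m i) := by
    rw [← (mem_finsuppAntidiag.1 hm).1, ← prod_pow_eq_pow_sum]
    exact prod_le_prod (fun _ _ ↦ by positivity) fun i _ ↦
      inv_exp_mul_pow_le_factorial_mul (m i) hδ.le
  have h3 := (mul_le_mul_of_nonneg_left h2 (norm_nonneg (a m))).trans h1
  rw [← le_div_iff₀ (by positivity)] at h3
  refine h3.trans (le_of_eq ?_)
  rw [div_pow, div_pow, mul_pow]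
  field_simp

theorem summable_pow_sum {r : ℝ} (hr : 0 ≤ r) (hr1 : r < 1) :
    Summable fun m : τ →₀ ℕ ↦ r ^ ∑ i, m i := by
  classical
  refine summable_of_sum_le (c := ∏ _i : τ, (1 - r)⁻¹) (fun m ↦ by positivity) fun s ↦ ?_
  set t : Finset (τ → ℕ) := s.image (fun m : τ →₀ ℕ ↦ (⇑m : τ → ℕ)) with ht
  have h1 : ∑ m ∈ s, r ^ ∑ i, m i = ∑ κ ∈ t, ∏ i, r ^ κ i := by
    rw [ht, sum_image (fun _ _ _ _ h ↦ DFunLike.coe_injective h)]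
    exact sum_congr rfl fun m _ ↦ (prod_pow_eq_pow_sum _ _ _).symm
  rw [h1]
  have h2 : t ⊆ Fintype.piFinset fun _ ↦ range (t.sup (fun κ ↦ univ.sup κ) + 1) := by
    intro κ hκ
    rw [Fintype.mem_piFinset]
    intro i
    rw [mem_range, Nat.lt_succ_iff]
    exact (le_sup (f := κ) (mem_univ i)).trans (le_sup (f := fun κ : τ → ℕ ↦ univ.sup κ) hκ)
  refine (sum_le_sum_of_subset_of_nonneg h2 fun _ _ _ ↦ by positivity).trans ?_
  rw [← prod_univ_sum (t := fun _ : τ ↦ range (t.sup (fun κ ↦ univ.sup κ) + 1))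
    (f := fun _ k ↦ r ^ k)]
  refine prod_le_prod (fun _ _ ↦ by positivity) fun i _ ↦ ?_
  rw [← tsum_geometric_of_lt_one hr hr1]
  exact (summable_geometric_of_lt_one hr hr1).sum_le_tsum _ fun _ _ ↦ by positivity

end FiniteDifference

section CoefficientDecay

open Filter Topology

variable {τ : Type*} [Fintype τ]

/-- The homogeneous part of degree `d` of a formal power series with coefficients `a`. -/
noncomputable def homogeneousPart [DecidableEq τ] (a : (τ →₀ ℕ) → ℂ) (d : ℕ) (x : τ → ℝ) : ℂ :=
  ∑ m ∈ Finset.finsuppAntidiag Finset.univ d, a m * ∏ i, (x i : ℂ) ^ m i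

theorem continuous_homogeneousPart [DecidableEq τ] (a : (τ →₀ ℕ) → ℂ) (d : ℕ) :
    Continuous (homogeneousPart a d) := by
  unfold homogeneousPart
  fun_prop

theorem exists_pos_homogeneousPart_ne_zero [DecidableEq τ] {a : (τ →₀ ℕ) → ℂ} {m : τ →₀ ℕ} (hm : a m ≠ 0) :
    ∃ y : τ → ℝ, (∀ i, 0 < y i) ∧ homogeneousPart a (∑ i, m i) y ≠ 0 := by
  by_contra! hcon
  set p : MvPolynomial τ ℂ :=
    ∑ m' ∈ Finset.finsuppAntidiag Finset.univ (∑ i, m i), monomial m' (a m') with hp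
  have hp0 : p = 0 := by
    refine funext_set (fun _ ↦ (fun r : ℝ ↦ (r : ℂ)) '' Set.Ioi 0)
      (fun _ ↦ (Set.Ioi_infinite 0).image Complex.ofReal_injective.injOn) fun x hx ↦ ?_
    choose y hy hyx using fun i ↦ hx i (Set.mem_univ i)
    obtain rfl : (fun i ↦ (y i : ℂ)) = x := _root_.funext hyx
    rw [map_zero, ← hcon y hy, hp, map_sum, homogeneousPart]
    refine Finset.sum_congr rfl fun m' _ ↦ ?_
    rw [eval_monomial, Finsupp.prod_fintype _ _ (by simp)]
  have : coeff m p = a m := by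
    rw [hp, coeff_sum]
    simp only [coeff_monomial]
    rw [Finset.sum_ite_eq', if_pos (by simp [Finset.mem_finsuppAntidiag])]
  rw [hp0, coeff_zero] at this
  exact hm this.symm

theorem coeff_aeval_C_mul_X [DecidableEq τ] (G : MvPolynomial τ ℂ) (y : τ → ℝ) (d : ℕ) :
    (aeval (fun i ↦ Polynomial.C (y i : ℂ) * Polynomial.X) G).coeff d =
      homogeneousPart (fun m ↦ coeff m G) d y := by
  rw [aeval_def, eval₂_eq', Polynomial.finsetSum_coeff, homogeneousPart]
  have h1 : ∀ m : τ →₀ ℕ, (algebraMap ℂ (Polynomial ℂ) (coeff m G) *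
      ∏ i, (Polynomial.C (y i : ℂ) * Polynomial.X) ^ m i).coeff d =
      if d = ∑ i, m i then coeff m G * ∏ i, (y i : ℂ) ^ m i else 0 := by
    intro m
    simp only [mul_pow, Finset.prod_mul_distrib, Finset.prod_pow_eq_pow_sum,
      ← Polynomial.C_pow, ← map_prod, Polynomial.algebraMap_eq]
    rw [← mul_assoc, ← Polynomial.C_mul, Polynomial.coeff_C_mul_X_pow]
  simp_rw [h1]
  rw [← Finset.sum_filter]
  refine Finset.sum_subset (fun m hm ↦ ?_) fun m hm hm' ↦ ?_
  · simp [Finset.mem_finsuppAntidiag, (Finset.mem_filter.1 hm).2]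
  · have : (∑ i, m i) = d := (Finset.mem_finsuppAntidiag.1 hm).1
    have : coeff m G = 0 := by
      by_contra hne
      exact hm' (Finset.mem_filter.2 ⟨mem_support_iff.2 hne, this.symm⟩)
    rw [this, zero_mul]

theorem eval_aeval_C_mul_X (G : MvPolynomial τ ℂ) (y : τ → ℝ) (t : ℂ) :
    (aeval (fun i ↦ Polynomial.C (y i : ℂ) * Polynomial.X) G).eval t =
      eval (fun i ↦ y i * t) G := by
  rw [aeval_def, eval₂_eq', eval_eq', Polynomial.eval_finsetSum]
  refine Finset.sum_congr rfl fun m _ ↦ ?_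
  simp [Polynomial.eval_prod]

/-- A coefficientwise limit of stable polynomials whose zero coefficients are also zero along the
sequence is the expansion of an entire function. -/
theorem summable_norm_mul_pow_of_isStable {a : (τ →₀ ℕ) → ℂ} (ha : ∃ m, a m ≠ 0)
    {G : ℕ → MvPolynomial τ ℂ} (hG : ∀ k, IsStable (G k))
    (hlim : ∀ m, Tendsto (fun k ↦ coeff m (G k)) atTop (𝓝 (a m)))
    (hzero : ∀ k m, a m = 0 → coeff m (G k) = 0) {R : ℝ} (hR : 0 ≤ R) :
    Summable fun m ↦ ‖a m‖ * R ^ ∑ i, m i := by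
  have hex : ∃ d, ∃ m, a m ≠ 0 ∧ ∑ i, m i = d := by
    obtain ⟨m, hm⟩ := ha
    exact ⟨_, m, hm, rfl⟩
  classical
  obtain ⟨m₀, hm₀, hd₀⟩ := Nat.find_spec hex
  have hmin : ∀ m, ∑ i, m i < Nat.find hex → a m = 0 := by
    intro m hm
    by_contra hne
    exact Nat.find_min hex hm ⟨m, hne, rfl⟩
  generalize Nat.find hex = d₀ at hd₀ hmin
  obtain ⟨y, hy, hyne⟩ := exists_pos_homogeneousPart_ne_zero hm₀
  rw [hd₀] at hyne
  obtain ⟨δ, hδ, hball⟩ := Metric.isOpen_iff.1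
    ((isOpen_compl_singleton (x := (0 : ℂ))).preimage (continuous_homogeneousPart a d₀)) y hyne
  set K : Set (τ → ℝ) := Set.Icc y (fun i ↦ y i + δ / 2) with hK
  have hKc : IsCompact K := isCompact_Icc
  have hKne : ∀ x ∈ K, homogeneousPart a d₀ x ≠ 0 := by
    intro x hx
    refine hball (Metric.mem_ball.2 (lt_of_le_of_lt ?_ (half_lt_self hδ)))
    refine (dist_pi_le_iff (by positivity)).2 fun i ↦ ?_
    rw [Real.dist_eq, abs_le]
    have := hx.1 i
    have := hx.2 i
    constructor <;> linarith
  set B : ℝ → (τ → ℝ) → ℝ := fun r x ↦ ‖homogeneousPart a d₀ x‖ *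
      Real.exp (‖homogeneousPart a (d₀ + 1) x‖ / ‖homogeneousPart a d₀ x‖ * r +
        (3 * (‖homogeneousPart a (d₀ + 1) x‖ / ‖homogeneousPart a d₀ x‖) ^ 2 +
          2 * (‖homogeneousPart a (d₀ + 2) x‖ / ‖homogeneousPart a d₀ x‖)) / 2 * r ^ 2) with hB
  have hBc : ∀ r, ContinuousOn (B r) K := by
    intro r
    have h0 := (continuous_homogeneousPart a d₀).norm.continuousOn (s := K)
    have h1 := ((continuous_homogeneousPart a (d₀ + 1)).norm.continuousOn (s := K)).div h0
      fun x hx ↦ norm_ne_zero_iff.2 (hKne x hx)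
    have h2 := ((continuous_homogeneousPart a (d₀ + 2)).norm.continuousOn (s := K)).div h0
      fun x hx ↦ norm_ne_zero_iff.2 (hKne x hx)
    exact h0.mul (((h1.mul_const r).add ((((h1.pow 2).const_mul 3).add
      (h2.const_mul 2)).div_const 2 |>.mul_const (r ^ 2))).rexp)
  have hbound : ∀ r, 0 < r → ∀ x ∈ K, ∀ d, ‖homogeneousPart a (d₀ + d) x‖ * r ^ d ≤ B r x := by
    intro r hr x hx d
    have hconv : ∀ d, Tendsto (fun k ↦ homogeneousPart (fun m ↦ coeff m (G k)) d x) atTop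
        (𝓝 (homogeneousPart a d x)) := fun d ↦
      tendsto_finsetSum _ fun m _ ↦ (hlim m).mul_const _
    have hx0 : ∀ i, 0 < x i := fun i ↦ (hy i).trans_le (hx.1 i)
    have hne := norm_ne_zero_iff.2 (hKne x hx)
    have h1 := ((hconv (d₀ + 1)).norm.div (hconv d₀).norm hne)
    have h2 := ((hconv (d₀ + 2)).norm.div (hconv d₀).norm hne)
    refine le_of_tendsto_of_tendsto ((hconv (d₀ + d)).norm.mul_const (r ^ d))
      ((hconv d₀).norm.mul ((Real.continuous_exp.tendsto _).comp
        ((h1.mul_const r).add (((((h1.pow 2).const_mul 3).add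
          (h2.const_mul 2)).div_const 2).mul_const (r ^ 2))))) ?_
    filter_upwards [(hconv d₀).eventually_ne (hKne x hx)] with k hk
    have := Polynomial.norm_coeff_add_mul_pow_le (m := d₀)
      (q := aeval (fun i ↦ Polynomial.C (x i : ℂ) * Polynomial.X) (G k)) (fun j hj ↦ ?_)
      (by rwa [coeff_aeval_C_mul_X]) (fun t ht ↦ ?_) d hr
    · simp only [coeff_aeval_C_mul_X] at this
      exact this
    · rw [coeff_aeval_C_mul_X, homogeneousPart]
      refine Finset.sum_eq_zero fun m hm ↦ ?_
      rw [hzero k m (hmin m ?_), zero_mul]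
      have : (∑ i, m i) = j := (Finset.mem_finsuppAntidiag.1 hm).1
      omega
    · rw [eval_aeval_C_mul_X]
      refine hG k _ fun i ↦ ?_
      rw [Complex.im_ofReal_mul]
      exact mul_pos (hx0 i) ht
  set L : ℝ := 2 * Real.exp 1 / (δ / 2) with hL
  have hLpos : 0 < L := by positivity
  set r : ℝ := 2 * L * (R + 1) with hr
  have hrpos : 0 < r := by positivity
  obtain ⟨M, hM⟩ := hKc.bddAbove_image (hBc r)
  have hM' : ∀ x ∈ K, B r x ≤ M := fun x hx ↦ hM ⟨x, hx, rfl⟩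
  have hM0 : 0 ≤ M := le_trans (by positivity)
    (hM' y ⟨le_rfl, fun i ↦ by simp only [le_add_iff_nonneg_right]; positivity⟩)
  refine Summable.of_nonneg_of_le (fun m ↦ by positivity) (fun m ↦ ?_)
    ((summable_pow_sum (τ := τ) (r := 1 / 2) (by norm_num) (by norm_num)).mul_left (M * r ^ d₀))
  rcases lt_or_ge (∑ i, m i) d₀ with hlt | hge
  · rw [hmin m hlt, norm_zero, zero_mul]
    positivity
  obtain ⟨d, hd⟩ := Nat.exists_eq_add_of_le hge
  have h1 := norm_coeff_le_of_bound_on_box (d := d₀ + d) a (y := y) (δ := δ / 2) (M := M / r ^ d)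
    (by positivity) (fun x hx ↦ ?_) (m := m) (by simp [Finset.mem_finsuppAntidiag, hd])
  · rw [hd]
    have h2 : L * R ≤ r / 2 := by rw [hr]; nlinarith
    calc ‖a m‖ * R ^ (d₀ + d) ≤ (L ^ (d₀ + d) * (M / r ^ d)) * R ^ (d₀ + d) := by gcongr
      _ = (L * R) ^ (d₀ + d) * (M / r ^ d) := by ring
      _ ≤ (r / 2) ^ (d₀ + d) * (M / r ^ d) := by gcongr
      _ = M * r ^ d₀ * (1 / 2) ^ (d₀ + d) := by
        rw [div_pow, pow_add r, one_div, inv_pow]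
        field_simp
  · rw [le_div_iff₀ (by positivity)]
    have hxK : x ∈ K := ⟨fun i ↦ (hx i).1, fun i ↦ (hx i).2⟩
    exact (hbound r hrpos x hxK d).trans (hM' x hxK)

end CoefficientDecay

section DominatedConvergence

open Filter Topology

theorem summable_norm_mul_norm_prod_pow {τ : Type*} [Fintype τ] {a : (τ →₀ ℕ) → ℂ}
    {R : ℝ} (hs : Summable fun m ↦ ‖a m‖ * R ^ ∑ i, m i) {y : τ → ℂ} (hy : ∀ i, ‖y i‖ ≤ R) :
    (∀ m, ‖a m * ∏ i, y i ^ m i‖ ≤ ‖a m‖ * R ^ ∑ i, m i) ∧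
      Summable fun m ↦ a m * ∏ i, y i ^ m i := by
  have h : ∀ m : τ →₀ ℕ, ‖a m * ∏ i, y i ^ m i‖ ≤ ‖a m‖ * R ^ ∑ i, m i := by
    intro m
    rw [norm_mul, norm_prod, ← Finset.prod_pow_eq_pow_sum]
    refine mul_le_mul_of_nonneg_left (Finset.prod_le_prod (fun _ _ ↦ by positivity) fun i _ ↦ ?_)
      (norm_nonneg _)
    rw [norm_pow]
    exact pow_le_pow_left₀ (norm_nonneg _) (hy i) _
  exact ⟨h, Summable.of_norm_bounded hs h⟩

theorem tendstoUniformlyOn_eval_of_coeff_eq_mul {τ : Type*} [Fintype τ] {a : (τ →₀ ℕ) → ℂ}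
    {G : ℕ → MvPolynomial τ ℂ} {κ : ℕ → (τ →₀ ℕ) → ℝ}
    (hcoeff : ∀ k m, coeff m (G k) = κ k m * a m) (h0 : ∀ k m, 0 ≤ κ k m)
    (h1 : ∀ k m, κ k m ≤ 1) (hκ : ∀ m, Tendsto (fun k ↦ κ k m) atTop (𝓝 1))
    (hs : ∀ R : ℝ, 0 ≤ R → Summable fun m ↦ ‖a m‖ * R ^ ∑ i, m i)
    {K : Set (τ → ℂ)} (hK : IsCompact K) :
    TendstoUniformlyOn (fun k y ↦ eval y (G k)) (fun y ↦ ∑' m, a m * ∏ i, y i ^ m i)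
      atTop K := by
  obtain ⟨R, hR⟩ := hK.isBounded.exists_norm_le
  have hyR : ∀ y ∈ K, ∀ i, ‖y i‖ ≤ |R| := fun y hy i ↦
    (norm_le_pi_norm y i).trans ((hR y hy).trans (le_abs_self R))
  have hsR := hs |R| (abs_nonneg R)
  have hlim : Tendsto (fun k ↦ ∑' m, (1 - κ k m) * (‖a m‖ * |R| ^ ∑ i, m i)) atTop (𝓝 0) := by
    have := tendsto_tsum_of_dominated_convergence
      (f := fun (k : ℕ) (m : τ →₀ ℕ) ↦ (1 - κ k m) * (‖a m‖ * |R| ^ ∑ i, m i))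
      (g := fun _ ↦ 0) (𝓕 := atTop) hsR (fun m ↦ by
        simpa using ((hκ m).const_sub 1).mul_const (‖a m‖ * |R| ^ ∑ i, m i))
      (Eventually.of_forall fun k m ↦ by
        rw [Real.norm_of_nonneg (mul_nonneg (sub_nonneg.2 (h1 k m)) (by positivity))]
        exact mul_le_of_le_one_left (by positivity) (by linarith [h0 k m]))
    simpa using this
  rw [Metric.tendstoUniformlyOn_iff]
  intro ε hε
  filter_upwards [hlim.eventually_lt_const hε] with k hk y hy
  refine lt_of_le_of_lt ?_ hk
  obtain ⟨hle, hsum⟩ := summable_norm_mul_norm_prod_pow hsR (hyR y hy)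
  have hev : HasSum (fun m ↦ coeff m (G k) * ∏ i, y i ^ m i) (eval y (G k)) := by
    rw [eval_eq']
    refine hasSum_sum_of_ne_finset_zero fun m hm ↦ ?_
    rw [notMem_support_iff.1 hm, zero_mul]
  have hterm : ∀ m, ‖a m * ∏ i, y i ^ m i - coeff m (G k) * ∏ i, y i ^ m i‖ ≤
      (1 - κ k m) * (‖a m‖ * |R| ^ ∑ i, m i) := by
    intro m
    have : a m * ∏ i, y i ^ m i - coeff m (G k) * ∏ i, y i ^ m i =
        ((1 - κ k m : ℝ) : ℂ) * (a m * ∏ i, y i ^ m i) := by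
      rw [hcoeff]
      push_cast
      ring
    rw [this, norm_mul, Complex.norm_real, Real.norm_of_nonneg (sub_nonneg.2 (h1 k m))]
    exact mul_le_mul_of_nonneg_left (hle m) (sub_nonneg.2 (h1 k m))
  have hsum' : Summable fun m ↦ (1 - κ k m) * (‖a m‖ * |R| ^ ∑ i, m i) :=
    Summable.of_nonneg_of_le
      (fun m ↦ mul_nonneg (sub_nonneg.2 (h1 k m)) (by positivity))
      (fun m ↦ mul_le_of_le_one_left (by positivity) (by linarith [h0 k m])) hsR
  rw [dist_eq_norm, ← hev.tsum_eq, ← hsum.tsum_sub hev.summable]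
  exact tsum_of_norm_bounded hsum'.hasSum hterm

end DominatedConvergence

section Backward

open Filter Topology

/-- The Jensen truncation with exponent `(k + 1, …, k + 1)`, with the `w`-variables divided by
`k + 1`. -/
noncomputable def scaledJensenTrunc {n : ℕ} {K : Type*} [Field K]
    (P : (Fin n →₀ ℕ) → MvPolynomial (Fin n) K) (k : ℕ) : MvPolynomial (Fin n ⊕ Fin n) K :=
  bind₁ (Sum.elim (fun i ↦ X (Sum.inl i)) fun i ↦ C (((k : K) + 1)⁻¹) * X (Sum.inr i))
    (jensenTrunc P (Finsupp.equivFunOnFinite.symm fun _ ↦ k + 1))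

theorem eval_scaledJensenTrunc {n : ℕ} (P : (Fin n →₀ ℕ) → MvPolynomial (Fin n) ℂ) (k : ℕ)
    (x : Fin n ⊕ Fin n → ℂ) :
    eval x (scaledJensenTrunc P k) =
      eval (Sum.elim (x ∘ Sum.inl) fun i ↦ ((k : ℂ) + 1)⁻¹ * x (Sum.inr i))
        (jensenTrunc P (Finsupp.equivFunOnFinite.symm fun _ ↦ k + 1)) := by
  rw [scaledJensenTrunc, ← coe_aeval_eq_eval, ← coe_aeval_eq_eval]
  simp only [RingHom.coe_coe]
  rw [aeval_bind₁]
  congr 2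
  ext i
  rcases i with i | i <;> simp

theorem IsStable.scaledJensenTrunc {n : ℕ} {P : (Fin n →₀ ℕ) → MvPolynomial (Fin n) ℂ} {k : ℕ}
    (h : IsStable (jensenTrunc P (Finsupp.equivFunOnFinite.symm fun _ ↦ k + 1))) :
    IsStable (scaledJensenTrunc P k) := by
  intro x hx
  rw [eval_scaledJensenTrunc]
  refine h _ fun i ↦ ?_
  rcases i with i | i
  · exact hx _
  · have : ((k : ℂ) + 1)⁻¹ = (((k : ℝ) + 1)⁻¹ : ℝ) := by push_cast; rfl
    rw [Sum.elim_inr, this, Complex.im_ofReal_mul]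
    exact mul_pos (by positivity) (hx _)

section Translation

variable {n : ℕ}

/-- The base point `(i, …, i, 0, …, 0)`, whose `z`-coordinates lie in the upper half-plane. -/
noncomputable def jensenBasePoint (n : ℕ) : Fin n ⊕ Fin n → ℂ :=
  Sum.elim (fun _ ↦ Complex.I) 0

/-- The term `P_α(z) w^α` expanded around the base point. -/
noncomputable def translatedTerm (P : (Fin n →₀ ℕ) → MvPolynomial (Fin n) ℂ) (α : Fin n →₀ ℕ) :
    MvPolynomial (Fin n ⊕ Fin n) ℂ :=
  rename Sum.inl (bind₁ (fun i ↦ X i + C Complex.I) (P α)) *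
    monomial (Finsupp.mapDomain Sum.inr α) 1

/-- The exponent of the `w`-variables in a monomial. -/
noncomputable def wExponent (m : Fin n ⊕ Fin n →₀ ℕ) : Fin n →₀ ℕ :=
  m.comapDomain Sum.inr Sum.inr_injective.injOn

theorem eval_translatedTerm (P : (Fin n →₀ ℕ) → MvPolynomial (Fin n) ℂ) (α : Fin n →₀ ℕ)
    (x : Fin n ⊕ Fin n → ℂ) :
    eval x (translatedTerm P α) =
      eval ((x + jensenBasePoint n) ∘ Sum.inl) (P α) * ∏ i, x (Sum.inr i) ^ α i := by
  rw [translatedTerm, map_mul, eval_rename, eval_monomial,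
    Finsupp.prod_mapDomain_index_inj Sum.inr_injective, Finsupp.prod_fintype _ _ (by simp),
    one_mul, ← coe_aeval_eq_eval, ← coe_aeval_eq_eval]
  simp only [RingHom.coe_coe]
  rw [aeval_bind₁]
  congr 3
  ext i
  simp [jensenBasePoint]

theorem wExponent_eq_of_coeff_translatedTerm_ne_zero
    {P : (Fin n →₀ ℕ) → MvPolynomial (Fin n) ℂ} {α : Fin n →₀ ℕ} {m : Fin n ⊕ Fin n →₀ ℕ}
    (h : coeff m (translatedTerm P α) ≠ 0) : wExponent m = α := by
  rw [translatedTerm, coeff_mul_monomial'] at h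
  split_ifs at h with hle
  · rw [mul_one] at h
    obtain ⟨u, hu⟩ : ∃ u : Fin n →₀ ℕ,
        u.mapDomain Sum.inl = m - Finsupp.mapDomain Sum.inr α := by
      by_contra! hcon
      exact h (coeff_rename_eq_zero _ _ _ fun u hu ↦ absurd hu (hcon u))
    ext j
    have h1 := DFunLike.congr_fun hu (Sum.inr j)
    have h2 := hle (Sum.inr j)
    rw [Finsupp.mapDomain_of_notMem_range _ _ (by simp), Finsupp.tsub_apply,
      Finsupp.mapDomain_apply Sum.inr_injective] at h1
    rw [Finsupp.mapDomain_apply Sum.inr_injective] at h2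
    rw [wExponent, Finsupp.comapDomain_apply]
    omega
  · exact absurd rfl h

/-- The Taylor coefficients around the base point. -/
noncomputable def translatedCoeff (P : (Fin n →₀ ℕ) → MvPolynomial (Fin n) ℂ)
    (m : Fin n ⊕ Fin n →₀ ℕ) : ℂ :=
  coeff m (translatedTerm P (wExponent m))

theorem exists_translatedCoeff_ne_zero {P : (Fin n →₀ ℕ) → MvPolynomial (Fin n) ℂ}
    (hP : ∃ α, P α ≠ 0) : ∃ m, translatedCoeff P m ≠ 0 := by
  obtain ⟨α, hα⟩ := hP
  obtain ⟨z, hz⟩ : ∃ z, eval z (P α) ≠ 0 := by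
    by_contra! hcon
    exact hα (MvPolynomial.funext fun z ↦ by simpa using hcon z)
  have hne : translatedTerm P α ≠ 0 := by
    intro h0
    have := eval_translatedTerm P α (Sum.elim z 1 - jensenBasePoint n)
    rw [h0, map_zero, sub_add_cancel, Sum.elim_comp_inl] at this
    exact hz (by simpa [jensenBasePoint] using this.symm)
  obtain ⟨m, hm⟩ := ne_zero_iff.1 hne
  refine ⟨m, ?_⟩
  rwa [translatedCoeff, wExponent_eq_of_coeff_translatedTerm_ne_zero hm]

theorem hasSum_eval_translatedTerm (P : (Fin n →₀ ℕ) → MvPolynomial (Fin n) ℂ)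
    (x : Fin n ⊕ Fin n → ℂ) (hx : Summable fun m ↦ translatedCoeff P m * ∏ i, x i ^ m i) :
    HasSum (fun α ↦ eval x (translatedTerm P α))
      (∑' m, translatedCoeff P m * ∏ i, x i ^ m i) := by
  refine HasSum.sigma ((Equiv.sigmaFiberEquiv (wExponent (n := n))).hasSum_iff.2 hx.hasSum)
    fun α ↦ ?_
  have h1 : HasSum (fun m ↦ coeff m (translatedTerm P α) * ∏ i, x i ^ m i)
      (eval x (translatedTerm P α)) := by
    rw [eval_eq']
    refine hasSum_sum_of_ne_finset_zero fun m hm ↦ ?_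
    rw [notMem_support_iff.1 hm, zero_mul]
  have h2 : Function.support (fun m ↦ coeff m (translatedTerm P α) * ∏ i, x i ^ m i) ⊆
      {m | wExponent m = α} := fun m hm ↦
    wExponent_eq_of_coeff_translatedTerm_ne_zero (left_ne_zero_of_mul hm)
  have h3 : HasSum (fun c : {m // wExponent m = α} ↦
      coeff c.1 (translatedTerm P α) * ∏ i, x i ^ c.1 i) (eval x (translatedTerm P α)) :=
    (hasSum_subtype_iff_of_support_subset h2).2 h1
  convert h3 using 2 with c
  obtain ⟨m, rfl⟩ := c
  rfl

/-- The scaled Jensen truncation expanded around the base point. -/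
noncomputable def translatedJensenTrunc (P : (Fin n →₀ ℕ) → MvPolynomial (Fin n) ℂ) (k : ℕ) :
    MvPolynomial (Fin n ⊕ Fin n) ℂ :=
  bind₁ (fun i ↦ X i + C (jensenBasePoint n i)) (scaledJensenTrunc P k)

theorem eval_translatedJensenTrunc (P : (Fin n →₀ ℕ) → MvPolynomial (Fin n) ℂ) (k : ℕ)
    (x : Fin n ⊕ Fin n → ℂ) :
    eval x (translatedJensenTrunc P k) = eval (x + jensenBasePoint n) (scaledJensenTrunc P k) := by
  rw [translatedJensenTrunc, ← coe_aeval_eq_eval, ← coe_aeval_eq_eval]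
  simp only [RingHom.coe_coe]
  rw [aeval_bind₁]
  congr 2
  ext i
  simp

/-- The factors by which the Taylor coefficients are damped in the scaled Jensen truncations. -/
noncomputable def jensenFactor (k : ℕ) (α : Fin n →₀ ℕ) : ℝ :=
  ∏ i, ((k + 1).descFactorial (α i) : ℝ) / ((k + 1 : ℕ) : ℝ) ^ α i

theorem jensenFactor_nonneg (k : ℕ) (α : Fin n →₀ ℕ) : 0 ≤ jensenFactor k α :=
  Finset.prod_nonneg fun _ _ ↦ by positivity

theorem jensenFactor_le_one (k : ℕ) (α : Fin n →₀ ℕ) : jensenFactor k α ≤ 1 := by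
  refine Finset.prod_le_one (fun _ _ ↦ by positivity) fun i _ ↦ ?_
  rw [div_le_one (by positivity)]
  exact_mod_cast Nat.descFactorial_le_pow _ _

theorem tendsto_jensenFactor (α : Fin n →₀ ℕ) :
    Tendsto (fun k ↦ jensenFactor k α) atTop (𝓝 1) := by
  have : ∀ i ∈ (Finset.univ : Finset (Fin n)), Tendsto (fun k : ℕ ↦
      ((k + 1).descFactorial (α i) : ℝ) / ((k + 1 : ℕ) : ℝ) ^ α i) atTop (𝓝 1) := by
    intro i _
    have h := (Asymptotics.isEquivalent_iff_tendsto_one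
      ((eventually_gt_atTop 0).mono fun k hk ↦ by positivity)).1 (isEquivalent_descFactorial (α i))
    exact h.comp (tendsto_add_atTop_nat 1)
  have h := tendsto_finsetProd _ this
  rwa [Finset.prod_const_one] at h

theorem coeff_translatedJensenTrunc (P : (Fin n →₀ ℕ) → MvPolynomial (Fin n) ℂ) (k : ℕ)
    (m : Fin n ⊕ Fin n →₀ ℕ) :
    coeff m (translatedJensenTrunc P k) =
      jensenFactor k (wExponent m) * translatedCoeff P m := by
  have h1 : translatedJensenTrunc P k =
      ∑ α ∈ Finset.Iic (Finsupp.equivFunOnFinite.symm fun _ : Fin n ↦ k + 1),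
        C (jensenFactor k α : ℂ) * translatedTerm P α := by
    refine MvPolynomial.funext fun x ↦ ?_
    rw [eval_translatedJensenTrunc, eval_scaledJensenTrunc, eval_jensenTrunc, map_sum]
    refine Finset.sum_congr rfl fun α _ ↦ ?_
    rw [map_mul, eval_C, eval_translatedTerm, Sum.elim_comp_inl, mul_left_comm]
    congr 1
    rw [jensenFactor, Complex.ofReal_prod, ← Finset.prod_mul_distrib]
    refine Finset.prod_congr rfl fun i _ ↦ ?_
    have : jensenBasePoint n (Sum.inr i) = 0 := rfl
    simp only [Sum.elim_inr, Pi.add_apply, this, add_zero, mul_pow,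
      Finsupp.equivFunOnFinite_symm_apply_apply]
    push_cast
    rw [inv_pow]
    ring
  rw [h1, coeff_sum]
  simp only [coeff_C_mul]
  by_cases hle : wExponent m ≤ Finsupp.equivFunOnFinite.symm fun _ : Fin n ↦ k + 1
  · rw [Finset.sum_eq_single_of_mem _ (Finset.mem_Iic.2 hle)]
    · rfl
    · intro α _ hα
      rw [mul_eq_zero]
      right
      by_contra hne
      exact hα (wExponent_eq_of_coeff_translatedTerm_ne_zero hne).symm
  · rw [Finset.sum_eq_zero]
    · obtain ⟨i, hi⟩ : ∃ i, k + 1 < wExponent m i := by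
        by_contra! hcon
        exact hle hcon
      rw [jensenFactor, Finset.prod_eq_zero (Finset.mem_univ i)
        (by rw [Nat.descFactorial_of_lt hi]; simp)]
      simp
    · intro α hα
      rw [mul_eq_zero]
      right
      by_contra hne
      rw [wExponent_eq_of_coeff_translatedTerm_ne_zero hne] at hle
      exact hle (Finset.mem_Iic.1 hα)

end Translation

theorem exists_tendstoUniformlyOn_scaledJensenTrunc {n : ℕ}
    {P : (Fin n →₀ ℕ) → MvPolynomial (Fin n) ℂ} (hP : ∃ α, P α ≠ 0)
    (hJ : ∀ β, IsStable (jensenTrunc P β) ∨ jensenTrunc P β = 0) :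
    ∃ F : (Fin n ⊕ Fin n → ℂ) → ℂ,
      (∀ zw, HasSum (fun α : Fin n →₀ ℕ ↦
        eval (zw ∘ Sum.inl) (P α) * ∏ i, zw (Sum.inr i) ^ α i) (F zw)) ∧
      ∃ k₀, (∀ k, IsStable (scaledJensenTrunc P (k + k₀))) ∧
        ∀ K, IsCompact K → TendstoUniformlyOn (fun k zw ↦ eval zw (scaledJensenTrunc P (k + k₀)))
          F atTop K := by
  obtain ⟨m₀, hm₀⟩ := exists_translatedCoeff_ne_zero hP
  obtain ⟨k₀, hk₀⟩ := eventually_atTop.1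
    ((tendsto_jensenFactor (wExponent m₀)).eventually_ne one_ne_zero)
  have hst : ∀ k, IsStable (scaledJensenTrunc P (k + k₀)) := by
    intro k
    refine IsStable.scaledJensenTrunc ((hJ _).resolve_right fun h0 ↦ ?_)
    have h1 : translatedJensenTrunc P (k + k₀) = 0 := by
      rw [translatedJensenTrunc, scaledJensenTrunc, h0, map_zero, map_zero]
    have h2 := coeff_translatedJensenTrunc P (k + k₀) m₀
    rw [h1, coeff_zero] at h2
    exact mul_ne_zero (Complex.ofReal_ne_zero.2 (hk₀ _ (Nat.le_add_left _ _))) hm₀ h2.symm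
  have hκ : ∀ m : Fin n ⊕ Fin n →₀ ℕ,
      Tendsto (fun k ↦ jensenFactor (k + k₀) (wExponent m)) atTop (𝓝 1) := fun m ↦
    (tendsto_jensenFactor _).comp (tendsto_add_atTop_nat k₀)
  have hs : ∀ R : ℝ, 0 ≤ R → Summable fun m ↦ ‖translatedCoeff P m‖ * R ^ ∑ i, m i := by
    intro R hR
    refine summable_norm_mul_pow_of_isStable ⟨m₀, hm₀⟩
      (G := fun k ↦ translatedJensenTrunc P (k + k₀)) (fun k x hx ↦ ?_) (fun m ↦ ?_)
      (fun k m hm ↦ by rw [coeff_translatedJensenTrunc, hm, mul_zero]) hR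
    · rw [eval_translatedJensenTrunc]
      refine hst k _ fun i ↦ ?_
      rw [Pi.add_apply, Complex.add_im]
      refine add_pos_of_pos_of_nonneg (hx i) ?_
      rcases i with i | i <;> simp [jensenBasePoint]
    · simp_rw [coeff_translatedJensenTrunc]
      simpa using ((Complex.continuous_ofReal.tendsto 1).comp (hκ m)).mul_const
        (translatedCoeff P m)
  set Φ : (Fin n ⊕ Fin n → ℂ) → ℂ := fun y ↦ ∑' m, translatedCoeff P m * ∏ i, y i ^ m i with hΦ
  refine ⟨fun zw ↦ Φ (zw - jensenBasePoint n), fun zw ↦ ?_, k₀, hst, fun K hK ↦ ?_⟩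
  · have h1 := hasSum_eval_translatedTerm P (zw - jensenBasePoint n)
      (summable_norm_mul_norm_prod_pow (hs _ (norm_nonneg _)) (norm_le_pi_norm _)).2
    simp only [eval_translatedTerm, sub_add_cancel] at h1
    convert h1 using 4 with α i
    simp [jensenBasePoint]
  · have hc : Continuous fun zw : Fin n ⊕ Fin n → ℂ ↦ zw - jensenBasePoint n := by fun_prop
    have h1 := tendstoUniformlyOn_eval_of_coeff_eq_mul
      (fun k m ↦ coeff_translatedJensenTrunc P (k + k₀) m) (fun k m ↦ jensenFactor_nonneg _ _)
      (fun k m ↦ jensenFactor_le_one _ _) hκ hs (hK.image hc)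
    have h2 := (h1.comp fun zw : Fin n ⊕ Fin n → ℂ ↦ zw - jensenBasePoint n).mono
      (Set.subset_preimage_image _ K)
    refine h2.congr (Eventually.of_forall fun k zw _ ↦ ?_)
    simp only [Function.comp_apply, eval_translatedJensenTrunc, sub_add_cancel]

end Backward

section RealCoefficients

theorem aeval_eq_eval_map {σ : Type*} (f : MvPolynomial σ ℝ) (z : σ → ℂ) :
    aeval z f = eval z (map (algebraMap ℝ ℂ) f) := by
  rw [aeval_def, eval_map]

theorem isRealStable_iff_isStable_map {σ : Type*} (f : MvPolynomial σ ℝ) :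
    IsRealStable f ↔ IsStable (map (algebraMap ℝ ℂ) f) := by
  simp only [IsRealStable, IsStable, aeval_eq_eval_map]

theorem map_algebraMap_eq_zero_iff {σ : Type*} (f : MvPolynomial σ ℝ) :
    map (algebraMap ℝ ℂ) f = 0 ↔ f = 0 :=
  map_eq_zero_iff _ (map_injective _ (algebraMap ℝ ℂ).injective)

theorem map_jensenTrunc {n : ℕ} (P : (Fin n →₀ ℕ) → MvPolynomial (Fin n) ℝ) (β : Fin n →₀ ℕ) :
    map (algebraMap ℝ ℂ) (jensenTrunc P β) =
      jensenTrunc (fun α ↦ map (algebraMap ℝ ℂ) (P α)) β := by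
  simp only [jensenTrunc, map_sum, map_mul, map_rename, map_monomial, map_one, map_natCast]

theorem map_scaledJensenTrunc {n : ℕ} (P : (Fin n →₀ ℕ) → MvPolynomial (Fin n) ℝ) (k : ℕ) :
    map (algebraMap ℝ ℂ) (scaledJensenTrunc P k) =
      scaledJensenTrunc (fun α ↦ map (algebraMap ℝ ℂ) (P α)) k := by
  rw [scaledJensenTrunc, scaledJensenTrunc, map_bind₁, map_jensenTrunc]
  congr 2
  ext1 i
  rcases i with i | i <;> simp

end RealCoefficients

theorem tendstoUniformlyOn_inv_natCast_add_one {E : Type*} (K : Set E) :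
    TendstoUniformlyOn (fun (k : ℕ) (_ : E) ↦ ((k : ℂ) + 1)⁻¹) (fun _ ↦ 0) Filter.atTop K := by
  have h : Filter.Tendsto (fun k : ℕ ↦ ((k : ℂ) + 1)⁻¹) Filter.atTop (nhds 0) := by
    simpa using tendsto_one_div_add_atTop_nhds_zero_nat (𝕜 := ℂ)
  exact h.tendstoUniformlyOn_const K

/-- Theorem 5 (Borcea–Brändén), for `𝕂 = ℂ` and for `𝕂 = ℝ`: a formal power
series `F(z,w) = ∑_{α ∈ ℕⁿ} P_α(z) w^α` with coefficients in `𝕂[z₁,…,zₙ]`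
converges on all of `ℂ^{2n}` to an entire function that is a limit, uniformly
on compact subsets of `ℂ^{2n}`, of stable polynomials in `2n` variables with
coefficients in `𝕂`, if and only if for every `β ∈ ℕⁿ` the polynomial
`∑_{α ≤ β} (β)_α P_α(z) w^α` is stable (with coefficients in `𝕂`) or
identically zero. -/
theorem power_series_laguerre_polya_iff_jensen_truncations (n : ℕ) :
    (∀ P : (Fin n →₀ ℕ) → MvPolynomial (Fin n) ℂ,
      ((∃ F : (Fin n ⊕ Fin n → ℂ) → ℂ,
        (∀ zw : Fin n ⊕ Fin n → ℂ,
          HasSum (fun α : Fin n →₀ ℕ =>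
            MvPolynomial.eval (zw ∘ Sum.inl) (P α) * ∏ i, zw (Sum.inr i) ^ α i)
            (F zw)) ∧
        ∃ g : ℕ → MvPolynomial (Fin n ⊕ Fin n) ℂ,
          (∀ k, IsStable (g k)) ∧
          ∀ K : Set (Fin n ⊕ Fin n → ℂ), IsCompact K →
            TendstoUniformlyOn (fun k zw => MvPolynomial.eval zw (g k)) F
              Filter.atTop K) ↔
      (∀ β : Fin n →₀ ℕ, IsStable (jensenTrunc P β) ∨ jensenTrunc P β = 0))) ∧
    (∀ P : (Fin n →₀ ℕ) → MvPolynomial (Fin n) ℝ,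
      ((∃ F : (Fin n ⊕ Fin n → ℂ) → ℂ,
        (∀ zw : Fin n ⊕ Fin n → ℂ,
          HasSum (fun α : Fin n →₀ ℕ =>
            MvPolynomial.aeval (zw ∘ Sum.inl) (P α) * ∏ i, zw (Sum.inr i) ^ α i)
            (F zw)) ∧
        ∃ g : ℕ → MvPolynomial (Fin n ⊕ Fin n) ℝ,
          (∀ k, IsRealStable (g k)) ∧
          ∀ K : Set (Fin n ⊕ Fin n → ℂ), IsCompact K →
            TendstoUniformlyOn (fun k zw => MvPolynomial.aeval zw (g k)) F
              Filter.atTop K) ↔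
      (∀ β : Fin n →₀ ℕ, IsRealStable (jensenTrunc P β) ∨ jensenTrunc P β = 0))) := by
  have hC1 : ∀ k : ℕ, ((k : ℂ) + 1)⁻¹ ≠ 0 := fun k ↦ inv_ne_zero (Nat.cast_add_one_ne_zero k)
  refine ⟨fun P ↦ ⟨?_, fun hJ ↦ ?_⟩, fun P ↦ ⟨?_, fun hJ ↦ ?_⟩⟩
  · rintro ⟨F, hF, g, hg, hlim⟩ β
    exact isStable_jensenTrunc_or_eq_zero hF hg hlim β
  · by_cases hP : ∃ α, P α ≠ 0
    · obtain ⟨F, hF, k₀, hst, hlim⟩ := exists_tendstoUniformlyOn_scaledJensenTrunc hP hJ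
      exact ⟨F, hF, _, hst, hlim⟩
    · push Not at hP
      refine ⟨fun _ ↦ 0, fun zw ↦ by simp [hP],
        fun k ↦ C (((k : ℂ) + 1)⁻¹), fun k z _ ↦ by simpa using hC1 k, fun K _ ↦ ?_⟩
      simpa using tendstoUniformlyOn_inv_natCast_add_one K
  · rintro ⟨F, hF, g, hg, hlim⟩ β
    rw [isRealStable_iff_isStable_map, ← map_algebraMap_eq_zero_iff, map_jensenTrunc]
    simp only [aeval_eq_eval_map] at hF hlim
    exact isStable_jensenTrunc_or_eq_zero (P := fun α ↦ map (algebraMap ℝ ℂ) (P α)) hF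
      (fun k ↦ (isRealStable_iff_isStable_map _).1 (hg k)) hlim β
  · simp only [isRealStable_iff_isStable_map, aeval_eq_eval_map]
    by_cases hP : ∃ α, P α ≠ 0
    · obtain ⟨F, hF, k₀, hst, hlim⟩ := exists_tendstoUniformlyOn_scaledJensenTrunc
        (P := fun α ↦ map (algebraMap ℝ ℂ) (P α))
        (hP.imp fun α h ↦ (map_algebraMap_eq_zero_iff _).not.2 h) fun β ↦ by
          simpa only [isRealStable_iff_isStable_map, ← map_algebraMap_eq_zero_iff,
            map_jensenTrunc] using hJ β
      refine ⟨F, hF, fun k ↦ scaledJensenTrunc P (k + k₀), ?_, ?_⟩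
      · simpa only [map_scaledJensenTrunc] using hst
      · simpa only [map_scaledJensenTrunc] using hlim
    · push Not at hP
      refine ⟨fun _ ↦ 0, fun zw ↦ by simp [hP],
        fun k ↦ C (((k : ℝ) + 1)⁻¹), fun k z _ ↦ by simpa using hC1 k, fun K _ ↦ ?_⟩
      simpa using tendstoUniformlyOn_inv_natCast_add_one K
end

section
/- (Lieb–Sokal lemma, multivariate form) Let P, Q ∈ ℂ[z₁,…,zₙ] and suppose the polynomial P(z) + w·Q(z) in the n+1 variables z₁,…,zₙ,w is stable. If the degree of P(z) + w·Q(z) in the variable zⱼ is at most one, then the polynomial P(z) − ∂Q(z)/∂zⱼ is either identically zero or stable. -/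
open MvPolynomial

/-- On the product of upper half-planes, a polynomial quotient omitting the open upper half-plane
has no zeros, unless its numerator is identically zero. -/
lemma eq_zero_of_forall_not_im_div_pos {σ : Type*} [Finite σ] (p q : MvPolynomial σ ℂ)
    (h : ∀ z : σ → ℂ, (∀ i, 0 < (z i).im) → eval z p ≠ 0 → ¬ 0 < (eval z q / eval z p).im)
    (z₀ : σ → ℂ) (hz₀ : ∀ i, 0 < (z₀ i).im) (hp : eval z₀ p ≠ 0) (hq : eval z₀ q = 0) :
    q = 0 := by
  refine MvPolynomial.funext fun z => ?_
  rw [map_zero]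
  let l : ℂ → σ → ℂ := fun t i => z₀ i + t * (z i - z₀ i)
  have hl0 : l 0 = z₀ := by ext i; simp [l]
  have hl1 : l 1 = z := by ext i; simp [l]
  have hanalytic (r : MvPolynomial σ ℂ) : AnalyticOnNhd ℂ (fun t => eval (l t) r) Set.univ := by
    intro t _
    have hl (i : σ) : AnalyticAt ℂ (fun t => l t i) t := by fun_prop
    exact AnalyticAt.aeval_mvPolynomial hl r
  have hp0 : eval (l 0) p ≠ 0 := by rwa [hl0]
  have hpne : ∀ᶠ t in nhds (0 : ℂ), eval (l t) p ≠ 0 :=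
    (hanalytic p 0 trivial).continuousAt.eventually_ne hp0
  have him : ∀ᶠ t in nhds (0 : ℂ), ∀ i, 0 < (l t i).im := by
    refine Filter.eventually_all.2 fun i => ?_
    have hc : ContinuousAt (fun t => (l t i).im) 0 := by fun_prop
    exact hc.eventually_const_lt (by simpa [hl0] using hz₀ i)
  have hdiv : AnalyticAt ℂ (fun t => eval (l t) q / eval (l t) p) 0 :=
    (hanalytic q 0 trivial).div (hanalytic p 0 trivial) hp0
  rcases hdiv.eventually_constant_or_nhds_le_map_nhds with hconst | hopen
  · have hq0 : (fun t => eval (l t) q) =ᶠ[nhds 0] fun _ => 0 := by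
      filter_upwards [hconst, hpne] with t ht htp
      rw [hl0, hq, zero_div, div_eq_zero_iff] at ht
      exact ht.resolve_right htp
    have := congrFun ((hanalytic q).eq_of_eventuallyEq analyticOnNhd_const hq0) 1
    simpa [hl1] using this
  · simp only [hl0, hq, zero_div] at hopen
    have hmem : {w : ℂ | ¬ 0 < w.im} ∈ nhds (0 : ℂ) := hopen <| by
      rw [Filter.mem_map]
      filter_upwards [hpne, him] with t htp hti using h _ hti htp
    have hc : ContinuousAt (fun ε : ℝ => (ε : ℂ) * Complex.I) 0 := by fun_prop
    have hev : ∀ᶠ ε : ℝ in nhds 0, ¬ 0 < ((ε : ℂ) * Complex.I).im :=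
      hc.eventually_mem (by rwa [Complex.ofReal_zero, zero_mul])
    obtain ⟨ε, hε, hpos⟩ :=
      ((hev.filter_mono nhdsWithin_le_nhds).and self_mem_nhdsWithin :
        ∀ᶠ ε in nhdsWithin (0 : ℝ) (Set.Ioi 0), _).exists
    exact absurd hpos (by simpa using hε)

/-- A polynomial of degree at most one in `X j` is affine in `X j`. -/
lemma eval_update_of_degreeOf_le_one {σ R : Type*} [DecidableEq σ] [CommRing R]
    (q : MvPolynomial σ R) (j : σ) (hq : q.degreeOf j ≤ 1) (z : σ → R) (s : R) :
    eval (Function.update z j s) q = eval z q + (s - z j) * eval z (pderiv j q) := by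
  rw [degreeOf_le_iff] at hq
  rw [q.as_sum]
  simp only [map_sum, Finset.mul_sum, ← Finset.sum_add_distrib]
  refine Finset.sum_congr rfl fun m hm => ?_
  have herase (y : σ → R) : eval y (monomial m (coeff m q)) =
      eval y (monomial (m.erase j) (coeff m q)) * y j ^ m j := by
    have := monomial_add_single (s := m.erase j) (n := j) (e := m j) (a := coeff m q)
    rw [Finsupp.erase_add_single] at this
    simp [this]
  have hupd : eval (Function.update z j s) (monomial (m.erase j) (coeff m q)) =
      eval z (monomial (m.erase j) (coeff m q)) := by
    rw [eval_monomial, eval_monomial]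
    congr 1
    refine Finset.prod_congr rfl fun i hi => ?_
    have hij : i ≠ j := by rintro rfl; simp at hi
    simp [hij]
  rw [herase, herase z, hupd, pderiv_monomial]
  have hmj := hq m hm
  interval_cases hk : m j
  · simp
  · have : m - Finsupp.single j 1 = m.erase j := by
      ext i
      by_cases hij : i = j
      · subst hij; simp [hk]
      · simp [hij]
    simp [this]
    ring

/-- The coefficient of the last variable has degree at most that of the whole polynomial in each
remaining variable. -/
lemma degreeOf_le_degreeOf_rename_add_X_mul {R : Type*} [CommRing R] {n : ℕ}
    (p q : MvPolynomial (Fin n) R) (j : Fin n) :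
    q.degreeOf j ≤
      (rename Fin.castSucc p + X (Fin.last n) * rename Fin.castSucc q).degreeOf
        (Fin.castSucc j) := by
  rw [degreeOf_le_iff]
  intro m hm
  set m' : Fin (n + 1) →₀ ℕ := Finsupp.single (Fin.last n) 1 + m.mapDomain Fin.castSucc
  have hp : coeff m' (rename Fin.castSucc p) = 0 := by
    refine coeff_rename_eq_zero _ _ _ fun u hu => ?_
    have hnot : Fin.last n ∉ Set.range (Fin.castSucc : Fin n → _) := by
      rintro ⟨i, hi⟩; exact (Fin.castSucc_lt_last i).ne hi
    have := DFunLike.congr_fun hu (Fin.last n)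
    simp [m', Finsupp.mapDomain_of_notMem_range _ _ hnot] at this
  have hm' : m' ∈ (rename Fin.castSucc p + X (Fin.last n) * rename Fin.castSucc q).support := by
    rw [mem_support_iff, coeff_add, hp, zero_add, coeff_X_mul,
      coeff_rename_mapDomain _ (Fin.castSucc_injective n)]
    exact mem_support_iff.1 hm
  have hle := monomial_le_degreeOf (Fin.castSucc j) hm'
  have hne : Fin.last n ≠ Fin.castSucc j := (Fin.castSucc_lt_last j).ne'
  simpa [m', Finsupp.mapDomain_apply (Fin.castSucc_injective n), Finsupp.single_apply, hne] using hle

/-- A complex number with positive imaginary part has minus its inverse in the same half-plane. -/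
lemma Complex.im_neg_inv_pos {w : ℂ} (hw : 0 < w.im) : 0 < (-w⁻¹).im := by
  have hne : w ≠ 0 := by rintro rfl; simp at hw
  have := Complex.normSq_pos.2 hne
  rw [Complex.neg_im, Complex.inv_im, neg_div, neg_neg]
  positivity

/-- The partial logarithmic derivative of a stable polynomial of degree at most one in `X j`
omits the open upper half-plane. -/
lemma IsStable.not_im_pderiv_div_pos {σ : Type*} {q : MvPolynomial σ ℂ} (hq : IsStable q)
    {j : σ} (hdeg : q.degreeOf j ≤ 1) {z : σ → ℂ} (hz : ∀ i, 0 < (z i).im) :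
    ¬ 0 < (eval z (pderiv j q) / eval z q).im := by
  classical
  intro hpos
  have hinv := Complex.im_neg_inv_pos hpos
  rw [inv_div] at hinv
  have hd : eval z (pderiv j q) ≠ 0 := by intro h0; simp [h0] at hpos
  refine hq (Function.update z j (z j + -(eval z q / eval z (pderiv j q)))) (fun i => ?_) ?_
  · by_cases hij : i = j
    · subst hij
      simpa only [Function.update_self, Complex.add_im] using add_pos (hz i) hinv
    · simpa [hij] using hz i
  · rw [eval_update_of_degreeOf_le_one q j hdeg]
    field_simp
    ring

/-- Lieb–Sokal lemma (multivariate form): if `P(z) + w·Q(z)` is a stable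
polynomial in the `n+1` variables `z₁,…,zₙ,w` (here `w` is the last variable
of `Fin (n+1)`) of degree at most one in the variable `z_j`, then
`P(z) − ∂Q(z)/∂z_j` is either identically zero or stable. -/
theorem lieb_sokal (n : ℕ) (P Q : MvPolynomial (Fin n) ℂ) (j : Fin n)
    (hstable : IsStable
      (rename Fin.castSucc P + X (Fin.last n) * rename Fin.castSucc Q))
    (hdeg : (rename Fin.castSucc P + X (Fin.last n) * rename Fin.castSucc Q).degreeOf
        (Fin.castSucc j) ≤ 1) :
    P - pderiv j Q = 0 ∨ IsStable (P - pderiv j Q) := by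
  have hF (z : Fin n → ℂ) (hz : ∀ i, 0 < (z i).im) (w : ℂ) (hw : 0 < w.im) :
      eval z P + w * eval z Q ≠ 0 := by
    have hs : (Fin.snoc z w : Fin (n + 1) → ℂ) ∘ Fin.castSucc = z := by ext i; simp
    have := hstable (Fin.snoc z w) (Fin.lastCases (by simpa using hw) (by simpa using hz))
    simpa [eval_rename, hs] using this
  by_cases hQ : Q = 0
  · right
    intro z hz
    simpa [hQ] using hF z hz Complex.I (by simp)
  have hQstable : IsStable Q := by
    intro z hz hQz
    have hPz : eval z P ≠ 0 := by simpa [hQz] using hF z hz Complex.I (by simp)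
    refine hQ (eq_zero_of_forall_not_im_div_pos P Q (fun y hy hPy hpos => ?_) z hz hPz hQz)
    have hQy : eval y Q ≠ 0 := by intro h0; simp [h0] at hpos
    refine hF y hy _ (Complex.im_neg_inv_pos hpos) ?_
    field_simp
    ring
  have hQdeg := (degreeOf_le_degreeOf_rename_add_X_mul P Q j).trans hdeg
  refine or_iff_not_imp_right.2 fun hR => ?_
  obtain ⟨z, hz, hRz⟩ : ∃ z : Fin n → ℂ, (∀ i, 0 < (z i).im) ∧ eval z (P - pderiv j Q) = 0 := by
    simpa [IsStable] using hR
  refine neg_eq_zero.1 (eq_zero_of_forall_not_im_div_pos Q (-(P - pderiv j Q))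
    (fun y hy hQy hpos => ?_) z hz (hQstable z hz) (by rw [map_neg, hRz, neg_zero]))
  have hlog := hQstable.not_im_pderiv_div_pos hQdeg hy
  have hw : 0 < (-(eval y P / eval y Q)).im := by
    rw [map_neg, map_sub, neg_sub, sub_div, Complex.sub_im] at hpos
    rw [Complex.neg_im]
    linarith
  refine hF y hy _ hw ?_
  field_simp
  ring
end

section
/- Let κ = (κ₁,…,κₙ) ∈ ℕⁿ and f ∈ ℂ_κ[z₁,…,zₙ]. Then f is stable if and only if its polarization Π↑_κ(f) is stable, where Π↑_κ(f) is the multi-affine polynomial in the variables {z_{ij} : 1 ≤ i ≤ n, 1 ≤ j ≤ κᵢ} determined on monomials by Π↑_κ(z^α) = C(κ,α)^{−1} · E_{α₁}(z_{11},…,z_{1κ₁}) ⋯ E_{αₙ}(z_{n1},…,z_{nκₙ}) for α ≤ κ, with E_k the k-th elementary symmetric polynomial. -/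
open MvPolynomial

/-- The polarization `Π↑_κ(f)` of a polynomial `f` of degree at most `κᵢ` in
the `i`-th variable: the multi-affine polynomial in the variables
`{z_{ij} : i, 1 ≤ j ≤ κᵢ}` given on monomials by
`Π↑_κ(z^α) = C(κ,α)⁻¹·E_{α₁}(z_{1,1},…,z_{1,κ₁})⋯E_{αₙ}(z_{n,1},…,z_{n,κₙ})`,
where `E_k` is the `k`-th elementary symmetric polynomial. -/
noncomputable def polarization {σ : Type*} [Fintype σ] (κ : σ → ℕ)
    (f : MvPolynomial σ ℂ) : MvPolynomial ((i : σ) × Fin (κ i)) ℂ :=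
  ∑ α ∈ f.support,
    (f.coeff α * ((∏ i, ((κ i).choose (α i) : ℕ) : ℕ) : ℂ)⁻¹) •
      ∏ i, rename (Sigma.mk i) (esymm (Fin (κ i)) ℂ (α i))

namespace Polynomial

/-- For `ζ` in the closed lower half-plane and `z` in the open upper half-plane, the point
`2i (im z) / (z - ζ)` lies in the closed unit disc centred at `1`. -/
lemma norm_two_im_div_sub_one_le {z ζ : ℂ} (hz : 0 < z.im) (hζ : ζ.im ≤ 0) :
    ‖2 * Complex.I * z.im * (1 / (z - ζ)) - 1‖ ≤ 1 := by
  have hne : z - ζ ≠ 0 := fun h => by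
    have := congrArg Complex.im h
    simp only [Complex.sub_im, Complex.zero_im] at this
    linarith
  have hsq : ‖2 * Complex.I * z.im - (z - ζ)‖ ^ 2 ≤ ‖z - ζ‖ ^ 2 := by
    rw [← Complex.normSq_eq_norm_sq, ← Complex.normSq_eq_norm_sq]
    simp [Complex.normSq_apply]
    nlinarith [mul_nonneg hz.le (neg_nonneg.2 hζ)]
  have heq : 2 * Complex.I * z.im * (1 / (z - ζ)) - 1 =
      (2 * Complex.I * z.im - (z - ζ)) / (z - ζ) := by
    field_simp
  rw [heq, norm_div, div_le_one (norm_pos_iff.2 hne)]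
  exact le_of_sq_le_sq hsq (norm_nonneg _)

/-- For distinct `z`, `w` in the open upper half-plane, the point `2i (im z) / (z - w)` lies
outside the closed unit disc centred at `1`. -/
lemma one_lt_norm_two_im_div_sub_one {z w : ℂ} (hz : 0 < z.im) (hw : 0 < w.im) (hne : z ≠ w) :
    1 < ‖2 * Complex.I * z.im * (1 / (z - w)) - 1‖ := by
  have hne' : z - w ≠ 0 := sub_ne_zero.2 hne
  have hsq : ‖z - w‖ ^ 2 < ‖2 * Complex.I * z.im - (z - w)‖ ^ 2 := by
    rw [← Complex.normSq_eq_norm_sq, ← Complex.normSq_eq_norm_sq]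
    simp [Complex.normSq_apply]
    nlinarith [mul_pos hz hw]
  have heq : 2 * Complex.I * z.im * (1 / (z - w)) - 1 =
      (2 * Complex.I * z.im - (z - w)) / (z - w) := by
    field_simp
  rw [heq, norm_div, one_lt_div (norm_pos_iff.2 hne')]
  exact lt_of_pow_lt_pow_left₀ 2 (norm_nonneg _) hsq

lemma norm_two_im_mul_sum_sub_card_le {z : ℂ} (hz : 0 < z.im) (s : Multiset ℂ)
    (hs : ∀ ζ ∈ s, ζ.im ≤ 0) :
    ‖2 * Complex.I * z.im * (s.map fun ζ => 1 / (z - ζ)).sum - s.card‖ ≤ s.card := by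
  induction s using Multiset.induction_on with
  | empty => simp
  | cons a s ih =>
    have h₁ := ih fun ζ hζ => hs ζ (Multiset.mem_cons_of_mem hζ)
    have h₂ := norm_two_im_div_sub_one_le hz (hs a (Multiset.mem_cons_self a s))
    rw [Multiset.map_cons, Multiset.sum_cons, Multiset.card_cons]
    push_cast
    calc _ = ‖(2 * Complex.I * z.im * (1 / (z - a)) - 1) +
          (2 * Complex.I * z.im * (s.map fun ζ => 1 / (z - ζ)).sum - s.card)‖ := by
          congr 1; ring
      _ ≤ 1 + s.card := (norm_add_le _ _).trans (add_le_add h₂ h₁)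
      _ = _ := add_comm _ _

/-- **Laguerre's theorem** for the upper half-plane: the polar derivative, with respect to a pole
in the open upper half-plane, of a polynomial without zeros in the open upper half-plane has no
zeros there. -/
lemma eval_polarDerivative_ne_zero {p : ℂ[X]} {k : ℕ} (hk : k ≠ 0) (hdeg : p.natDegree ≤ k)
    (hp : ∀ z : ℂ, 0 < z.im → p.eval z ≠ 0) {w z : ℂ} (hw : 0 < w.im) (hz : 0 < z.im) :
    (C (k : ℂ) * p + (C w - X) * derivative p).eval z ≠ 0 := by
  intro h
  simp only [eval_add, eval_mul, eval_C, eval_sub, eval_X] at h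
  have hpz := hp z hz
  have hk' : (k : ℂ) ≠ 0 := Nat.cast_ne_zero.2 hk
  have hne : z ≠ w := by
    rintro rfl
    simp [hk', hpz] at h
  have hsplit : p.Splits := IsAlgClosed.splits p
  have hsum := hsplit.eval_derivative_div_eval_of_ne_zero hpz
  have hroots : ∀ ζ ∈ p.roots, ζ.im ≤ 0 := fun ζ hζ => by
    by_contra! hpos
    exact hp ζ hpos (isRoot_of_mem_roots hζ)
  have hbound := norm_two_im_mul_sum_sub_card_le hz p.roots hroots
  have hcard : p.roots.card ≤ k := (card_roots' p).trans hdeg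
  have hval : (p.roots.map fun ζ => 1 / (z - ζ)).sum = k * (1 / (z - w)) := by
    rw [← hsum]
    have := sub_ne_zero.2 hne
    field_simp
    linear_combination -h
  rw [hval] at hbound
  have hlt := one_lt_norm_two_im_div_sub_one hz hw hne
  have hle : ‖(k : ℂ) * (2 * Complex.I * z.im * (1 / (z - w)) - 1)‖ ≤ k := by
    calc _ = ‖(2 * Complex.I * z.im * (k * (1 / (z - w))) - p.roots.card) +
          -((k - p.roots.card : ℕ) : ℂ)‖ := by
          rw [Nat.cast_sub hcard]; congr 1; ring
      _ ≤ p.roots.card + (k - p.roots.card : ℕ) := by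
          refine (norm_add_le _ _).trans (add_le_add hbound ?_)
          rw [norm_neg, Complex.norm_natCast]
      _ = k := by rw [Nat.cast_sub hcard]; ring
  rw [norm_mul, Complex.norm_natCast] at hle
  have hkpos : (0 : ℝ) < k := by positivity
  nlinarith

/-- The symmetric multi-affine form of a polynomial `p` of degree at most `card s`, evaluated at
the entries of `s`. -/
noncomputable def polarEval (s : Multiset ℂ) (p : ℂ[X]) : ℂ :=
  ∑ m ∈ Finset.range (s.card + 1), p.coeff m * (s.esymm m / (s.card.choose m : ℂ))

end Polynomial

lemma Multiset.esymm_cons_succ {R : Type*} [CommSemiring R] (a : R) (s : Multiset R) (m : ℕ) :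
    (a ::ₘ s).esymm (m + 1) = s.esymm (m + 1) + a * s.esymm m := by
  simp [Multiset.esymm, Multiset.powersetCard_cons, Multiset.sum_map_mul_left]

lemma Multiset.esymm_eq_zero_of_card_lt {R : Type*} [CommSemiring R] {s : Multiset R} {m : ℕ}
    (h : s.card < m) : s.esymm m = 0 := by
  simp [Multiset.esymm, Multiset.powersetCard_eq_empty _ h]

namespace Polynomial

lemma coeff_polarDerivative (a : ℂ) (k : ℕ) (p : ℂ[X]) (m : ℕ) :
    (C (k : ℂ) * p + (C a - X) * derivative p).coeff m =
      ((k : ℂ) - m) * p.coeff m + a * ((m + 1) * p.coeff (m + 1)) := by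
  rw [coeff_add, coeff_C_mul, sub_mul, coeff_sub, coeff_C_mul, coeff_derivative]
  rcases m with _ | m
  · rw [coeff_X_mul_zero]
    push_cast
    ring
  · rw [coeff_X_mul, coeff_derivative]
    push_cast
    ring

lemma polarEval_cons (a : ℂ) (s : Multiset ℂ) (p : ℂ[X]) :
    ((s.card + 1 : ℕ) : ℂ) * polarEval (a ::ₘ s) p =
      polarEval s (C ((s.card + 1 : ℕ) : ℂ) * p + (C a - X) * derivative p) := by
  set d := s.card with hd
  have hsplit : ∀ m, (a ::ₘ s).esymm m =
      s.esymm m + if m = 0 then 0 else a * s.esymm (m - 1) := by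
    intro m
    rcases m with _ | m
    · simp [Multiset.esymm]
    · simp [Multiset.esymm_cons_succ]
  have hfst : ∀ m ∈ Finset.range (d + 1),
      (d + 1 : ℂ) / ((d + 1).choose m : ℂ) = ((d + 1 : ℂ) - m) / (d.choose m : ℂ) := by
    intro m hm
    have hm' : m ≤ d := by simpa [Nat.lt_succ_iff] using hm
    have h := congrArg (Nat.cast : ℕ → ℂ) (Nat.choose_mul_succ_eq d m)
    rw [Nat.cast_mul, Nat.cast_mul, Nat.cast_sub (by omega)] at h
    push_cast at h
    have h₁ : (d.choose m : ℂ) ≠ 0 := Nat.cast_ne_zero.2 (Nat.choose_pos hm').ne'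
    have h₂ : ((d + 1).choose m : ℂ) ≠ 0 := Nat.cast_ne_zero.2 (Nat.choose_pos (by omega)).ne'
    field_simp
    linear_combination h
  have hsnd : ∀ m ∈ Finset.range (d + 1),
      (d + 1 : ℂ) / ((d + 1).choose (m + 1) : ℂ) = ((m : ℂ) + 1) / (d.choose m : ℂ) := by
    intro m hm
    have hm' : m ≤ d := by simpa [Nat.lt_succ_iff] using hm
    have h := congrArg (Nat.cast : ℕ → ℂ) (Nat.add_one_mul_choose_eq d m)
    push_cast at h
    have h₁ : (d.choose m : ℂ) ≠ 0 := Nat.cast_ne_zero.2 (Nat.choose_pos hm').ne'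
    have h₂ : ((d + 1).choose (m + 1) : ℂ) ≠ 0 :=
      Nat.cast_ne_zero.2 (Nat.choose_pos (by omega)).ne'
    field_simp
    linear_combination h
  rw [polarEval, polarEval, Multiset.card_cons, ← hd, Finset.mul_sum]
  have hterm : ∀ m, ((d + 1 : ℕ) : ℂ) *
      (p.coeff m * ((a ::ₘ s).esymm m / ((d + 1).choose m : ℂ))) =
      p.coeff m * s.esymm m * ((d + 1 : ℂ) / ((d + 1).choose m : ℂ)) +
      if m = 0 then 0 else
        p.coeff m * (a * s.esymm (m - 1)) * ((d + 1 : ℂ) / ((d + 1).choose m : ℂ)) := by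
    intro m
    rw [hsplit]
    split_ifs <;> push_cast <;> ring
  rw [Finset.sum_congr rfl fun m _ => hterm m, Finset.sum_add_distrib, Finset.sum_range_succ,
    Multiset.esymm_eq_zero_of_card_lt (s := s) (m := d + 1) (by omega),
    Finset.sum_range_succ' (fun m => if m = 0 then (0 : ℂ) else _)]
  simp only [mul_zero, zero_mul, add_zero, if_true, Nat.add_eq_zero_iff, one_ne_zero, and_false,
    if_false, Nat.add_sub_cancel]
  rw [← Finset.sum_add_distrib]
  refine Finset.sum_congr rfl fun m hm => ?_
  rw [hfst m hm, hsnd m hm, coeff_polarDerivative]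
  push_cast
  ring

/-- **Grace–Walsh–Szegő theorem** for the upper half-plane. -/
theorem polarEval_ne_zero (s : Multiset ℂ) (hs : ∀ a ∈ s, 0 < a.im) {p : ℂ[X]}
    (hdeg : p.natDegree ≤ s.card) (hp : ∀ z : ℂ, 0 < z.im → p.eval z ≠ 0) :
    polarEval s p ≠ 0 := by
  induction s using Multiset.induction_on generalizing p with
  | empty =>
    have hpC := eq_C_of_natDegree_le_zero (by simpa using hdeg)
    have h := hp Complex.I (by simp)
    rw [hpC, eval_C] at h
    simpa [polarEval, Multiset.esymm] using h
  | cons a s ih =>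
    rw [Multiset.card_cons] at hdeg
    have ha := hs a (Multiset.mem_cons_self a s)
    have key := ih (fun b hb => hs b (Multiset.mem_cons_of_mem hb))
      (p := C ((s.card + 1 : ℕ) : ℂ) * p + (C a - X) * derivative p) ?_
      fun z hz => eval_polarDerivative_ne_zero (Nat.succ_ne_zero _) hdeg hp ha hz
    · rw [← polarEval_cons] at key
      exact right_ne_zero_of_mul key
    · rw [natDegree_le_iff_coeff_eq_zero]
      intro m hm
      rw [coeff_polarDerivative, coeff_eq_zero_of_natDegree_lt (n := m + 1) (by omega)]
      rcases Nat.lt_or_ge (s.card + 1) m with hlt | hge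
      · rw [coeff_eq_zero_of_natDegree_lt (n := m) (by omega)]
        ring
      · obtain rfl : m = s.card + 1 := by omega
        ring

lemma polarEval_sum_monomial {ι : Type*} (s : Multiset ℂ) (t : Finset ι) (e : ι → ℕ)
    (c : ι → ℂ) (he : ∀ i ∈ t, e i ≤ s.card) :
    polarEval s (∑ i ∈ t, monomial (e i) (c i)) =
      ∑ i ∈ t, c i * (s.esymm (e i) / (s.card.choose (e i) : ℂ)) := by
  simp only [polarEval, finsetSum_coeff, Finset.sum_mul]
  rw [Finset.sum_comm]
  refine Finset.sum_congr rfl fun i hi => ?_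
  rw [Finset.sum_eq_single_of_mem (e i) (by simpa [Nat.lt_succ_iff] using he i hi)]
  · simp
  · intro m _ hm
    simp [coeff_monomial, hm.symm]

end Polynomial

lemma eval_polarization {σ : Type*} [Fintype σ] (κ : σ → ℕ) (f : MvPolynomial σ ℂ)
    (z : ((i : σ) × Fin (κ i)) → ℂ) :
    eval z (polarization κ f) = ∑ α ∈ f.support, f.coeff α *
      ∏ i, ((Finset.univ.val.map fun j => z ⟨i, j⟩).esymm (α i) /
        ((κ i).choose (α i) : ℂ)) := by
  simp only [polarization, map_sum, smul_eval, map_prod, eval_rename]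
  refine Finset.sum_congr rfl fun α _ => ?_
  rw [Finset.prod_div_distrib, Nat.cast_prod, mul_assoc, inv_mul_eq_div]
  congr 2
  refine Finset.prod_congr rfl fun i _ => ?_
  rw [← aeval_esymm_eq_multiset_esymm (σ := Fin (κ i)) (R := ℂ)]
  rfl

/-- Evaluating the polarization on the diagonal recovers the polynomial. -/
lemma eval_polarization_diagonal {σ : Type*} [Fintype σ] (κ : σ → ℕ) (f : MvPolynomial σ ℂ)
    (hf : ∀ i, f.degreeOf i ≤ κ i) (w : σ → ℂ) :
    eval (fun p : (i : σ) × Fin (κ i) => w p.1) (polarization κ f) = eval w f := by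
  rw [eval_polarization, eval_eq']
  refine Finset.sum_congr rfl fun α hα => ?_
  congr 1
  refine Finset.prod_congr rfl fun i _ => ?_
  have hle : α i ≤ κ i := (monomial_le_degreeOf i hα).trans (hf i)
  have hne : ((κ i).choose (α i) : ℂ) ≠ 0 := Nat.cast_ne_zero.2 (Nat.choose_pos hle).ne'
  rw [Finset.esymm_map_val, Finset.sum_congr rfl (g := fun _ => w i ^ α i)
    fun t ht => by dsimp only; rw [Finset.prod_const, (Finset.mem_powersetCard.1 ht).2]]
  rw [Finset.sum_const, Finset.card_powersetCard, Finset.card_univ, Fintype.card_fin,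
    nsmul_eq_mul, mul_div_cancel_left₀ _ hne]

/-- A stable polynomial does not vanish when polarized in any finite set of its variables. -/
lemma IsStable.sum_partial_polarization_ne_zero {σ : Type*} [Fintype σ] [DecidableEq σ]
    {κ : σ → ℕ} {f : MvPolynomial σ ℂ} (hf : ∀ i, f.degreeOf i ≤ κ i) (hs : IsStable f)
    (v : (i : σ) → Multiset ℂ) (hcard : ∀ i, (v i).card = κ i) (hv : ∀ i, ∀ a ∈ v i, 0 < a.im)
    (S : Finset σ) (w : σ → ℂ) (hw : ∀ i, 0 < (w i).im) :
    ∑ α ∈ f.support, f.coeff α * ∏ i, (if i ∈ S then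
      (v i).esymm (α i) / ((κ i).choose (α i) : ℂ) else w i ^ α i) ≠ 0 := by
  induction S using Finset.induction_on generalizing w with
  | empty => simpa [eval_eq'] using hs w hw
  | insert i S hi ih =>
    let c : (σ →₀ ℕ) → ℂ := fun α => f.coeff α * ∏ j ∈ Finset.univ.erase i, (if j ∈ S then
      (v j).esymm (α j) / ((κ j).choose (α j) : ℂ) else w j ^ α j)
    have hdeg : ∀ α ∈ f.support, α i ≤ (v i).card := fun α hα =>
      ((monomial_le_degreeOf i hα).trans (hf i)).trans (hcard i).ge
    have key := Polynomial.polarEval_ne_zero (v i) (hv i)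
      (p := ∑ α ∈ f.support, Polynomial.monomial (α i) (c α))
      (Polynomial.natDegree_sum_le_of_forall_le _ _ fun α hα =>
        (Polynomial.natDegree_monomial_le _).trans (hdeg α hα)) ?_
    · rw [Polynomial.polarEval_sum_monomial _ _ _ _ hdeg, hcard] at key
      convert key using 2 with α
      rw [mul_assoc, ← Finset.prod_erase_mul _ _ (Finset.mem_univ i),
        if_pos (Finset.mem_insert_self i S)]
      congr 2
      refine Finset.prod_congr rfl fun j hj => ?_
      simp [Finset.mem_insert, Finset.ne_of_mem_erase hj]
    · intro z hz
      have h := ih (Function.update w i z) fun j => by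
        rcases eq_or_ne j i with rfl | hj
        · simpa using hz
        · simpa [hj] using hw j
      rw [Polynomial.eval_finsetSum]
      convert h using 2 with α
      rw [Polynomial.eval_monomial, mul_assoc, ← Finset.prod_erase_mul _ _ (Finset.mem_univ i),
        if_neg hi, Function.update_self]
      congr 2
      refine Finset.prod_congr rfl fun j hj => ?_
      rw [Function.update_of_ne (Finset.ne_of_mem_erase hj)]

/-- Grace–Walsh–Szegő via polarization: a polynomial `f` of degree at most
`κᵢ` in each variable `zᵢ` is stable if and only if its polarization
`Π↑_κ(f)` is stable. -/
theorem stable_iff_polarization_stable (n : ℕ) (κ : Fin n → ℕ)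
    (f : MvPolynomial (Fin n) ℂ) (hf : ∀ i, f.degreeOf i ≤ κ i) :
    IsStable f ↔ IsStable (polarization κ f) := by
  refine ⟨fun h z hz => ?_, fun h w hw => ?_⟩
  · rw [eval_polarization]
    simpa using h.sum_partial_polarization_ne_zero hf
      (fun i => Finset.univ.val.map fun j => z ⟨i, j⟩) (by simp) (by simpa using fun i j => hz ⟨i, j⟩)
      Finset.univ (fun _ => Complex.I) (by simp)
  · rw [← eval_polarization_diagonal κ f hf]
    exact h _ fun p => hw p.1
end

section
/- (Generalized Jensen multipliers) Fix β ∈ ℕⁿ. The linear operators on ℂ[z₁,…,zₙ] defined on monomials by z^α ↦ J(α,β)·z^α and by z^α ↦ (β)_α·z^α (for all α ∈ ℕⁿ) both preserve stability, i.e., map every stable polynomial to a stable polynomial or to zero. Here (β)_α = β!/(β−α)! if α ≤ β and (β)_α = 0 otherwise, and J(α,β) = (β)_α·β^{−α} with the convention k^{±k} = 1 for k = 0. -/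
open MvPolynomial

/-- The diagonal operator `z^α ↦ (β)_α·z^α`, where
`(β)_α = β!/(β-α)! = ∏ᵢ βᵢ·(βᵢ-1)⋯(βᵢ-αᵢ+1)` if `α ≤ β` and `(β)_α = 0`
otherwise. -/
noncomputable def fallingFactorialOp {n : ℕ} (β : Fin n →₀ ℕ)
    (f : MvPolynomial (Fin n) ℂ) : MvPolynomial (Fin n) ℂ :=
  ∑ α ∈ f.support,
    ((∏ i, (β i).descFactorial (α i) : ℕ) : ℂ) • monomial α (f.coeff α)

/-- The diagonal operator `z^α ↦ J(α,β)·z^α`, where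
`J(α,β) = (β)_α·β^{-α}` (with the convention `0⁰ = 1`). -/
noncomputable def jensenMultiplierOp {n : ℕ} (β : Fin n →₀ ℕ)
    (f : MvPolynomial (Fin n) ℂ) : MvPolynomial (Fin n) ℂ :=
  ∑ α ∈ f.support,
    (((∏ i, (β i).descFactorial (α i) : ℕ) : ℂ) *
        (∏ i, ((β i : ℂ)) ^ (α i))⁻¹) • monomial α (f.coeff α)

section OneVariable

open Polynomial

lemma Complex.im_sum_one_div_pos {s : Multiset ℂ} (hs : s ≠ 0) (h : ∀ z ∈ s, z.im < 0) :
    0 < (s.map fun z ↦ 1 / z).sum.im := by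
  have hpos : ∀ z : ℂ, z.im < 0 → 0 < (1 / z).im := by
    intro z hz
    have hz0 : z ≠ 0 := by rintro rfl; simp at hz
    rw [one_div, Complex.inv_im]
    exact div_pos (by linarith) (Complex.normSq_pos.2 hz0)
  induction s using Multiset.induction_on with
  | empty => exact absurd rfl hs
  | cons a s ih =>
    have ha := hpos a (h a (by simp))
    rcases eq_or_ne s 0 with rfl | hs0
    · simpa using ha
    · have := ih hs0 fun z hz ↦ h z (by simp [hz])
      simp only [Multiset.map_cons, Multiset.sum_cons, Complex.add_im]
      linarith

/-- If `q` has no zero in the open lower half-plane and `ζ ≠ 0` is not in the open upper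
half-plane, then `q' - ζ q` has no zero in the open lower half-plane. -/
lemma Polynomial.eval_derivative_sub_C_mul_ne_zero {q : ℂ[X]}
    (hq : ∀ x : ℂ, x.im < 0 → q.eval x ≠ 0) {ζ : ℂ} (hζ0 : ζ ≠ 0) (hζ : ζ.im ≤ 0) :
    ∀ x : ℂ, x.im < 0 → (derivative q - C ζ * q).eval x ≠ 0 := by
  intro x hx h
  have hqx := hq x hx
  have h1 : (derivative q).eval x / q.eval x = ζ := by
    rw [div_eq_iff hqx]
    simpa [sub_eq_zero] using h
  rw [(IsAlgClosed.splits q).eval_derivative_div_eval_of_ne_zero hqx] at h1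
  have h2 : (((q.roots.map fun r ↦ x - r)).map fun z ↦ 1 / z).sum = ζ := by
    simpa [Multiset.map_map] using h1
  by_cases hr : q.roots.map (fun r ↦ x - r) = 0
  · rw [hr] at h2
    exact hζ0 (by simpa using h2.symm)
  · have := Complex.im_sum_one_div_pos hr (by
      intro z hz
      obtain ⟨r, hr, rfl⟩ := Multiset.mem_map.1 hz
      have : 0 ≤ r.im := by
        by_contra! hneg
        exact hq r hneg (isRoot_of_mem_roots hr)
      simp only [Complex.sub_im]
      linarith)
    rw [h2] at this
    linarith

/-- A differential operator `g(d/dx)`, with `g` nonvanishing at `0` and on the open upper half-plane,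
preserves the absence of zeros in the open lower half-plane. -/
lemma Polynomial.eval_aeval_derivative_ne_zero_s15 {g : ℂ[X]} (hg0 : g.eval 0 ≠ 0)
    (hg : ∀ x : ℂ, 0 < x.im → g.eval x ≠ 0) {q : ℂ[X]}
    (hq : ∀ x : ℂ, x.im < 0 → q.eval x ≠ 0) :
    ∀ x : ℂ, x.im < 0 →
      (aeval (derivative : Module.End ℂ ℂ[X]) g q).eval x ≠ 0 := by
  have hgne : g ≠ 0 := by rintro rfl; simp at hg0
  have hprod : ∀ s : Multiset ℂ, (∀ ζ ∈ s, ζ ≠ 0 ∧ ζ.im ≤ 0) → ∀ x : ℂ, x.im < 0 →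
      (aeval (derivative : Module.End ℂ ℂ[X]) (s.map fun ζ ↦ X - C ζ).prod q).eval x ≠ 0 := by
    intro s
    induction s using Multiset.induction_on with
    | empty => intro _; simpa using hq
    | cons a s ih =>
      intro hs
      have ih := ih fun ζ hζ ↦ hs ζ (by simp [hζ])
      have ha := hs a (by simp)
      have := eval_derivative_sub_C_mul_ne_zero ih ha.1 ha.2
      simpa [Module.End.mul_apply, ← smul_eq_C_mul] using this
  intro x hx
  rw [(IsAlgClosed.splits g).eq_prod_roots]
  have := hprod g.roots (by
    intro ζ hζ
    have hz : g.eval ζ = 0 := isRoot_of_mem_roots hζ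
    exact ⟨fun h ↦ hg0 (h ▸ hz), by by_contra! h; exact hg ζ h hz⟩) x hx
  simpa [Module.End.mul_apply, ← smul_eq_C_mul, hgne] using this

lemma Polynomial.eval_aeval_derivative_X_pow (p : ℂ[X]) (b : ℕ) {w : ℂ} (hw : w ≠ 0) :
    w ^ b * (aeval (derivative : Module.End ℂ ℂ[X]) p (X ^ b)).eval w⁻¹ =
      ∑ k ∈ Finset.range (b + 1), (b.descFactorial k : ℂ) * p.coeff k * w ^ k := by
  induction p using Polynomial.induction_on' with
  | add p q hp hq =>
    simp only [map_add, LinearMap.add_apply, eval_add, coeff_add, mul_add, add_mul,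
      Finset.sum_add_distrib, hp, hq]
  | monomial m a =>
    simp only [aeval_monomial, Module.End.mul_apply, Module.algebraMap_end_apply,
      Module.End.pow_apply, iterate_derivative_X_pow_eq_smul, coeff_monomial]
    simp only [eval_smul, eval_pow, eval_X, mul_ite, mul_zero, ite_mul, zero_mul,
      Finset.sum_ite_eq, Finset.mem_range, smul_eq_mul]
    split_ifs with h
    · have : w ^ b = w ^ m * w ^ (b - m) := by rw [← pow_add]; congr 1; omega
      rw [this, inv_pow]
      field_simp
    · simp [Nat.descFactorial_eq_zero_iff_lt.2 (by omega : b < m)]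

/-- If `p` does not vanish on the upper half-plane, then `∑ (b)ₖ pₖ wᵏ` vanishes at a point of the
upper half-plane only if `X ^ (b + 1)` divides `p`. -/
lemma Polynomial.X_pow_dvd_of_sum_descFactorial_eq_zero {p : ℂ[X]} {b : ℕ}
    (hp : ∀ x : ℂ, 0 < x.im → p.eval x ≠ 0) {w : ℂ} (hw : 0 < w.im)
    (h : ∑ k ∈ Finset.range (b + 1), (b.descFactorial k : ℂ) * p.coeff k * w ^ k = 0) :
    X ^ (b + 1) ∣ p := by
  have hp0 : p ≠ 0 := by rintro rfl; exact hp Complex.I (by simp) (by simp)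
  have hw0 : w ≠ 0 := by rintro rfl; simp at hw
  obtain ⟨g, hpg, hg⟩ := p.exists_eq_pow_rootMultiplicity_mul_and_not_dvd hp0 0
  set m := p.rootMultiplicity 0
  rw [C_0, sub_zero] at hpg hg
  by_cases hm : b + 1 ≤ m
  · exact hpg ▸ (pow_dvd_pow X hm).mul_right g
  exfalso
  rw [← eval_aeval_derivative_X_pow p b hw0] at h
  have h := (mul_eq_zero.1 h).resolve_left (pow_ne_zero _ hw0)
  rw [hpg, mul_comm, map_mul, Module.End.mul_apply] at h
  refine eval_aeval_derivative_ne_zero_s15 (g := g) ?_ ?_ ?_ w⁻¹ ?_ h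
  · rwa [Ne, ← coeff_zero_eq_eval_zero, ← X_dvd_iff]
  · intro x hx h0
    exact hp x hx (by rw [hpg]; simp [h0])
  · intro x hx
    have hx0 : x ≠ 0 := by rintro rfl; simp at hx
    have hd : b.descFactorial m ≠ 0 := by
      rw [Ne, Nat.descFactorial_eq_zero_iff_lt]; omega
    simp [Module.End.pow_apply, iterate_derivative_X_pow_eq_smul, hx0, hd]
  · rw [Complex.inv_im]
    exact div_neg_of_neg_of_pos (by linarith) (Complex.normSq_pos.2 hw0)

lemma Polynomial.norm_eval_le_of_forall_ne_zero {p : ℂ[X]} {r : ℝ} (hr : 0 < r)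
    (hp : ∀ t : ℂ, ‖t‖ < r → p.eval t ≠ 0) (t : ℂ) :
    ‖p.eval t‖ ≤ ‖p.eval 0‖ * (1 + ‖t‖ / r) ^ p.natDegree := by
  have hprod : ∀ s : Multiset ℂ, (∀ ζ ∈ s, r ≤ ‖ζ‖) →
      ‖(s.map fun ζ ↦ t - ζ).prod‖ ≤
        ‖(s.map fun ζ ↦ 0 - ζ).prod‖ * (1 + ‖t‖ / r) ^ Multiset.card s := by
    intro s
    induction s using Multiset.induction_on with
    | empty => simp
    | cons a s ih =>
      intro hs
      have ih := ih fun ζ hζ ↦ hs ζ (by simp [hζ])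
      have ha := hs a (by simp)
      have h1 : ‖t - a‖ ≤ ‖0 - a‖ * (1 + ‖t‖ / r) := by
        have h2 : ‖t‖ ≤ ‖a‖ * (‖t‖ / r) := by
          calc ‖t‖ = r * (‖t‖ / r) := by field_simp
            _ ≤ _ := by gcongr
        calc ‖t - a‖ ≤ ‖t‖ + ‖a‖ := norm_sub_le _ _
          _ ≤ _ := by rw [zero_sub, norm_neg]; linarith
      simp only [Multiset.map_cons, Multiset.prod_cons, norm_mul, Multiset.card_cons, pow_succ]
      calc _ ≤ (‖0 - a‖ * (1 + ‖t‖ / r)) *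
            (‖(s.map fun ζ ↦ 0 - ζ).prod‖ * (1 + ‖t‖ / r) ^ Multiset.card s) := by gcongr
        _ = _ := by ring
  have hs := IsAlgClosed.splits p
  rw [hs.eval_eq_prod_roots, hs.eval_eq_prod_roots, norm_mul, norm_mul, mul_assoc,
    hs.natDegree_eq_card_roots]
  gcongr
  refine hprod _ fun ζ hζ ↦ ?_
  by_contra! h
  exact hp ζ h (isRoot_of_mem_roots hζ)

/-- Divisibility by a power of `X` passes through a norm bound on the upper half-plane. -/
lemma Polynomial.X_pow_dvd_of_norm_eval_le {p q : ℂ[X]} {C : ℝ}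
    (h : ∀ w : ℂ, 0 < w.im → ‖q.eval w‖ ≤ C * ‖p.eval w‖) {m : ℕ} (hp : X ^ m ∣ p) :
    X ^ m ∣ q := by
  induction m generalizing p q with
  | zero => simp
  | succ m ih =>
    have hX : X ∣ q := by
      rw [X_dvd_iff, coeff_zero_eq_eval_zero]
      have hp0 : p.eval 0 = 0 := by
        rw [← coeff_zero_eq_eval_zero, ← X_dvd_iff]
        exact (dvd_pow_self X m.succ_ne_zero).trans hp
      have hmem : (0 : ℂ) ∈ closure {w : ℂ | 0 < w.im} := by
        rw [Complex.closure_setOfPred_lt_im]; simp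
      have hle : ‖q.eval 0‖ ≤ C * ‖p.eval 0‖ :=
        closure_minimal (t := {w : ℂ | ‖q.eval w‖ ≤ C * ‖p.eval w‖}) h
          (isClosed_le (by fun_prop) (by fun_prop)) hmem
      simpa [hp0] using hle
    obtain ⟨q', rfl⟩ := hX
    obtain ⟨p', rfl⟩ := (dvd_pow_self X m.succ_ne_zero).trans hp
    rw [pow_succ'] at hp ⊢
    refine mul_dvd_mul_left X (ih (p := p') ?_ ((mul_dvd_mul_iff_left X_ne_zero).1 hp))
    intro w hw
    have hw0 : 0 < ‖w‖ := by
      rw [norm_pos_iff]; rintro rfl; simp at hw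
    have := h w hw
    simp only [eval_mul, eval_X, norm_mul] at this
    exact le_of_mul_le_mul_left (by linarith) hw0

end OneVariable

section SeveralVariables

variable {σ : Type*}

/-- The diagonal operator `z^α ↦ c(α)·z^α`. -/
noncomputable def MvPolynomial.diagonalOp (c : (σ →₀ ℕ) → ℂ) (f : MvPolynomial σ ℂ) :
    MvPolynomial σ ℂ :=
  ∑ α ∈ f.support, c α • monomial α (f.coeff α)

lemma MvPolynomial.coeff_diagonalOp (c : (σ →₀ ℕ) → ℂ) (f : MvPolynomial σ ℂ) (α : σ →₀ ℕ) :
    (diagonalOp c f).coeff α = c α * f.coeff α := by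
  classical
  simp only [diagonalOp, coeff_sum, coeff_smul, coeff_monomial, smul_eq_mul, mul_ite, mul_zero,
    Finset.sum_ite_eq']
  split_ifs with h
  · rfl
  · rw [notMem_support_iff.1 h, mul_zero]

lemma MvPolynomial.diagonalOp_diagonalOp (c d : (σ →₀ ℕ) → ℂ) (f : MvPolynomial σ ℂ) :
    diagonalOp c (diagonalOp d f) = diagonalOp (c * d) f := by
  ext α
  simp [coeff_diagonalOp, mul_assoc]

lemma MvPolynomial.diagonalOp_add (c : (σ →₀ ℕ) → ℂ) (f g : MvPolynomial σ ℂ) :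
    diagonalOp c (f + g) = diagonalOp c f + diagonalOp c g := by
  ext α
  simp [coeff_diagonalOp, mul_add]

lemma MvPolynomial.diagonalOp_monomial (c : (σ →₀ ℕ) → ℂ) (α : σ →₀ ℕ) (a : ℂ) :
    diagonalOp c (monomial α a) = monomial α (c α * a) := by
  classical
  ext γ
  rw [coeff_diagonalOp, coeff_monomial, coeff_monomial]
  split_ifs with h
  · rw [h]
  · simp

variable [DecidableEq σ]

/-- The restriction of `f` to the complex line through `z` parallel to the `i`-th axis. -/
noncomputable def MvPolynomial.axisRestriction (i : σ) (z : σ → ℂ) :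
    MvPolynomial σ ℂ →ₐ[ℂ] Polynomial ℂ :=
  aeval (Function.update (fun j ↦ Polynomial.C (z j)) i Polynomial.X)

lemma MvPolynomial.eval_axisRestriction (i : σ) (z : σ → ℂ) (w : ℂ) (f : MvPolynomial σ ℂ) :
    (axisRestriction i z f).eval w = eval (Function.update z i w) f := by
  have : ((Polynomial.aeval w).comp (axisRestriction i z) : MvPolynomial σ ℂ →ₐ[ℂ] ℂ) =
      aeval (Function.update z i w) := by
    ext j
    rcases eq_or_ne j i with rfl | h
    · simp [axisRestriction]
    · simp [axisRestriction, h]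
  simpa [Polynomial.coe_aeval_eq_eval, aeval_eq_eval] using DFunLike.congr_fun this f

variable [Fintype σ]

lemma MvPolynomial.axisRestriction_monomial (i : σ) (z : σ → ℂ) (α : σ →₀ ℕ) (a : ℂ) :
    axisRestriction i z (monomial α a) =
      Polynomial.monomial (α i) (a * ∏ j ∈ Finset.univ.erase i, z j ^ α j) := by
  rw [axisRestriction, aeval_monomial, Finsupp.prod_fintype _ _ (by simp),
    ← Finset.mul_prod_erase _ _ (Finset.mem_univ i),
    Finset.prod_congr rfl (g := fun j ↦ Polynomial.C (z j ^ α j)) (by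
      intro j hj
      simp [Finset.ne_of_mem_erase hj])]
  rw [← map_prod, Function.update_self, Polynomial.algebraMap_eq,
    ← Polynomial.C_mul_X_pow_eq_monomial, map_mul]
  ring

lemma MvPolynomial.coeff_axisRestriction_diagonalOp (c : ℕ → ℂ) (i : σ) (z : σ → ℂ)
    (f : MvPolynomial σ ℂ) (k : ℕ) :
    (axisRestriction i z (diagonalOp (fun α ↦ c (α i)) f)).coeff k =
      c k * (axisRestriction i z f).coeff k := by
  induction f using MvPolynomial.induction_on' with
  | add p q hp hq => simp only [diagonalOp_add, map_add, Polynomial.coeff_add, hp, hq, mul_add]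
  | monomial α a =>
    rw [diagonalOp_monomial, axisRestriction_monomial, axisRestriction_monomial,
      Polynomial.coeff_monomial, Polynomial.coeff_monomial]
    split_ifs with h
    · rw [h]; ring
    · simp

lemma MvPolynomial.eval_axisRestriction_descFactorial (b : ℕ) (i : σ) (z : σ → ℂ)
    (f : MvPolynomial σ ℂ) (w : ℂ) :
    eval (Function.update z i w) (diagonalOp (fun α ↦ (b.descFactorial (α i) : ℂ)) f) =
      ∑ k ∈ Finset.range (b + 1),
        (b.descFactorial k : ℂ) * (axisRestriction i z f).coeff k * w ^ k := by
  have hc := coeff_axisRestriction_diagonalOp (fun k ↦ (b.descFactorial k : ℂ)) i z f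
  rw [← eval_axisRestriction, Polynomial.eval_eq_sum_range' (n := b + 1)]
  · simp only [hc]
  · rw [Nat.lt_succ_iff, Polynomial.natDegree_le_iff_coeff_eq_zero]
    intro k hk
    rw [hc, Nat.descFactorial_eq_zero_iff_lt.2 hk]
    simp

/-- Two slices of a stable polynomial are comparable, uniformly in the free variable. -/
lemma IsStable.exists_norm_eval_update_le {f : MvPolynomial σ ℂ} (hf : IsStable f)
    (i : σ) {z₀ z₁ : σ → ℂ} (h₀ : ∀ j, 0 < (z₀ j).im) :
    ∃ C : ℝ, ∀ w : ℂ, 0 < w.im →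
      ‖eval (Function.update z₁ i w) f‖ ≤ C * ‖eval (Function.update z₀ i w) f‖ := by
  obtain ⟨r, hr, hball⟩ : ∃ r > 0, ∀ t : ℂ, ‖t‖ < r →
      ∀ j, 0 < (z₀ j + t * (z₁ j - z₀ j)).im := by
    have hev : ∀ᶠ t in nhds (0 : ℂ), ∀ j, 0 < (z₀ j + t * (z₁ j - z₀ j)).im := by
      rw [Filter.eventually_all]
      intro j
      have hcont : Continuous fun t : ℂ ↦ (z₀ j + t * (z₁ j - z₀ j)).im := by fun_prop
      exact hcont.continuousAt.eventually_const_lt (by simpa using h₀ j)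
    obtain ⟨r, hr, h⟩ := Metric.eventually_nhds_iff.1 hev
    exact ⟨r, hr, fun t ht ↦ h (by simpa using ht)⟩
  refine ⟨(1 + 1 / r) ^ f.totalDegree, fun w hw ↦ ?_⟩
  set u₀ := Function.update z₀ i w
  set u₁ := Function.update z₁ i w
  set P : Polynomial ℂ :=
    aeval (fun j ↦ Polynomial.C (u₀ j) + Polynomial.X * Polynomial.C (u₁ j - u₀ j)) f
  have hP : ∀ t : ℂ, P.eval t = eval (fun j ↦ u₀ j + t * (u₁ j - u₀ j)) f := by
    intro t
    have : ((Polynomial.aeval t).comp (aeval fun j ↦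
        Polynomial.C (u₀ j) + Polynomial.X * Polynomial.C (u₁ j - u₀ j)) :
          MvPolynomial σ ℂ →ₐ[ℂ] ℂ) = aeval fun j ↦ u₀ j + t * (u₁ j - u₀ j) := by
      ext j
      simp
    have h := DFunLike.congr_fun this f
    rwa [AlgHom.comp_apply, Polynomial.coe_aeval_eq_eval, aeval_eq_eval] at h
  have hdeg : P.natDegree ≤ f.totalDegree := by
    rw [← mul_one f.totalDegree]
    refine aeval_natDegree_le f le_rfl _ fun j ↦ ?_
    rw [mul_comm]
    exact Polynomial.natDegree_add_le_of_degree_le (by simp)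
      ((Polynomial.natDegree_C_mul_le _ _).trans Polynomial.natDegree_X_le)
  have hroot : ∀ t : ℂ, ‖t‖ < r → P.eval t ≠ 0 := by
    intro t ht
    rw [hP]
    refine hf _ fun j ↦ ?_
    rcases eq_or_ne j i with rfl | hj
    · simpa [u₀, u₁] using hw
    · simpa [u₀, u₁, hj] using hball t ht j
  have hle := Polynomial.norm_eval_le_of_forall_ne_zero hr hroot 1
  rw [hP, hP] at hle
  simp only [one_mul, zero_mul, add_zero, add_sub_cancel, norm_one] at hle
  calc _ ≤ _ := hle
    _ ≤ ‖eval u₀ f‖ * (1 + 1 / r) ^ f.totalDegree := by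
      gcongr
      have := one_div_pos.2 hr
      linarith
    _ = _ := mul_comm _ _

omit [DecidableEq σ] [Fintype σ] in
lemma MvPolynomial.eq_zero_of_eval_eq_zero_of_im_pos [Finite σ] {f : MvPolynomial σ ℂ}
    (h : ∀ z : σ → ℂ, (∀ i, 0 < (z i).im) → eval z f = 0) : f = 0 := by
  have hinf : {w : ℂ | 0 < w.im}.Infinite :=
    infinite_of_mem_nhds Complex.I
      ((isOpen_lt continuous_const Complex.continuous_im).mem_nhds (by simp))
  refine funext_set (fun _ ↦ {w : ℂ | 0 < w.im}) (fun _ ↦ hinf) fun z hz ↦ ?_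
  rw [h z fun i ↦ hz i (Set.mem_univ i), map_zero]

omit [DecidableEq σ] in
lemma IsStable.diagonalOp_descFactorial {f : MvPolynomial σ ℂ} (hf : IsStable f) (b : ℕ) (i : σ) :
    diagonalOp (fun α ↦ (b.descFactorial (α i) : ℂ)) f = 0 ∨
      IsStable (diagonalOp (fun α ↦ (b.descFactorial (α i) : ℂ)) f) := by
  classical
  rw [or_iff_not_imp_right]
  intro hns
  simp only [IsStable, not_forall, not_not] at hns
  obtain ⟨z₀, hz₀, h₀⟩ := hns
  have hres : ∀ z : σ → ℂ, (∀ j, 0 < (z j).im) → ∀ w : ℂ, 0 < w.im →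
      (axisRestriction i z f).eval w ≠ 0 := by
    intro z hz w hw
    rw [eval_axisRestriction]
    refine hf _ fun j ↦ ?_
    rcases eq_or_ne j i with rfl | hj
    · simpa using hw
    · simpa [hj] using hz j
  have hdvd₀ : Polynomial.X ^ (b + 1) ∣ axisRestriction i z₀ f := by
    refine Polynomial.X_pow_dvd_of_sum_descFactorial_eq_zero (hres z₀ hz₀) (hz₀ i) ?_
    rw [← eval_axisRestriction_descFactorial, Function.update_eq_self, h₀]
  refine eq_zero_of_eval_eq_zero_of_im_pos fun z hz ↦ ?_
  obtain ⟨C, hC⟩ := hf.exists_norm_eval_update_le i (z₁ := z) hz₀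
  have hdvd := Polynomial.X_pow_dvd_of_norm_eval_le (q := axisRestriction i z f) (C := C)
    (by simpa only [eval_axisRestriction] using hC) hdvd₀
  rw [← Function.update_eq_self i z, eval_axisRestriction_descFactorial]
  refine Finset.sum_eq_zero fun k hk ↦ ?_
  rw [Polynomial.X_pow_dvd_iff.1 hdvd k (Finset.mem_range.1 hk)]
  simp

omit [DecidableEq σ] in
lemma IsStable.diagonalOp_prod_descFactorial {f : MvPolynomial σ ℂ} (hf : IsStable f)
    (β : σ → ℕ) (s : Finset σ) :
    diagonalOp (fun α ↦ ∏ i ∈ s, ((β i).descFactorial (α i) : ℂ)) f = 0 ∨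
      IsStable (diagonalOp (fun α ↦ ∏ i ∈ s, ((β i).descFactorial (α i) : ℂ)) f) := by
  classical
  induction s using Finset.induction_on with
  | empty =>
    have : diagonalOp (fun _ ↦ 1) f = f := by ext; simp [coeff_diagonalOp]
    simpa [this] using Or.inr hf
  | insert i s hi ih =>
    have hcomp : diagonalOp (fun α ↦ ∏ j ∈ insert i s, ((β j).descFactorial (α j) : ℂ)) f =
        diagonalOp (fun α ↦ ((β i).descFactorial (α i) : ℂ))
          (diagonalOp (fun α ↦ ∏ j ∈ s, ((β j).descFactorial (α j) : ℂ)) f) := by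
      rw [diagonalOp_diagonalOp]
      congr 1
      ext α
      simp [Finset.prod_insert hi]
    rw [hcomp]
    rcases ih with h | h
    · left
      rw [h]
      simp [diagonalOp]
    · exact h.diagonalOp_descFactorial _ i

end SeveralVariables

lemma fallingFactorialOp_eq_diagonalOp {n : ℕ} (β : Fin n →₀ ℕ) (f : MvPolynomial (Fin n) ℂ) :
    fallingFactorialOp β f =
      diagonalOp (fun α ↦ ∏ i, ((β i).descFactorial (α i) : ℂ)) f := by
  simp [fallingFactorialOp, diagonalOp]

lemma eval_jensenMultiplierOp {n : ℕ} (β : Fin n →₀ ℕ) (f : MvPolynomial (Fin n) ℂ)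
    (z : Fin n → ℂ) :
    eval z (jensenMultiplierOp β f) =
      eval (fun i ↦ z i / (if β i = 0 then 1 else β i : ℕ)) (fallingFactorialOp β f) := by
  simp only [jensenMultiplierOp, fallingFactorialOp, map_sum, smul_eval, eval_monomial,
    Finsupp.prod_fintype _ _ fun _ ↦ pow_zero _]
  refine Finset.sum_congr rfl fun α _ ↦ ?_
  rw [← Finset.prod_inv_distrib, Nat.cast_prod, mul_left_comm, mul_left_comm (∏ i, _ : ℂ)]
  simp only [← Finset.prod_mul_distrib]
  congr 1
  refine Finset.prod_congr rfl fun i _ ↦ ?_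
  rcases eq_or_ne (β i) 0 with h | h
  · rcases Nat.eq_zero_or_pos (α i) with ha | ha
    · simp [ha]
    · simp [h, Nat.descFactorial_eq_zero_iff_lt.2 ha]
  · simp only [h, if_false, div_pow]
    ring

/-- Generalized Jensen multipliers: for every fixed `β ∈ ℕⁿ`, the diagonal
operators `z^α ↦ J(α,β)·z^α` and `z^α ↦ (β)_α·z^α` preserve stability, i.e.
they map every stable polynomial to a stable polynomial or to zero. -/
theorem jensen_multipliers_preserve_stability (n : ℕ) (β : Fin n →₀ ℕ) :
    (∀ f : MvPolynomial (Fin n) ℂ, IsStable f →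
        jensenMultiplierOp β f = 0 ∨ IsStable (jensenMultiplierOp β f)) ∧
    (∀ f : MvPolynomial (Fin n) ℂ, IsStable f →
        fallingFactorialOp β f = 0 ∨ IsStable (fallingFactorialOp β f)) := by
  have hfall : ∀ f : MvPolynomial (Fin n) ℂ, IsStable f →
      fallingFactorialOp β f = 0 ∨ IsStable (fallingFactorialOp β f) := fun f hf ↦ by
    rw [fallingFactorialOp_eq_diagonalOp]
    exact hf.diagonalOp_prod_descFactorial β Finset.univ
  refine ⟨fun f hf ↦ ?_, hfall⟩
  rcases hfall f hf with h | h
  · left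
    refine MvPolynomial.funext fun z ↦ ?_
    rw [eval_jensenMultiplierOp, h, map_zero, map_zero]
  · right
    intro z hz
    rw [eval_jensenMultiplierOp]
    refine h _ fun i ↦ ?_
    rw [Complex.div_natCast_im]
    refine div_pos (hz i) (Nat.cast_pos.2 ?_)
    split_ifs <;> omega
end
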